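/- Let N be a super nebula under an ordering θ such that every star of N under θ is a 1-left middle star or a left star and every super 2-nebula of N under θ is a super right 2-nebula, and let G be a right triangular galaxy under an ordering α having exactly one triangle under α. Then there exists ε > 0 such that every {N,G}-free tournament T contains a transitive subtournament of size at least |T|^ε. -/

import Mathlib

open Finset

/-- A tournament on vertex set `Fin n`: `adj u v` means there is an arc from `u` to `v`. -/
structure Tournament (n : ℕ) where
  adj : Fin n → Fin n → Prop
  asymm : ∀ u v, adj u v → ¬ adj v u
  total : ∀ u v, u ≠ v → adj u v ∨ adj v u

namespace Tournament

variable {n N : ℕ}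

/-- The position of vertex `v` in the ordering `θ`, where `θ k` is the `k`-th vertex. -/
def pos (θ : Equiv.Perm (Fin n)) (v : Fin n) : Fin n := θ.symm v

/-- The arc `u → v` of `T` is a backward arc under the ordering `θ`. -/
def Backward (T : Tournament n) (θ : Equiv.Perm (Fin n)) (u v : Fin n) : Prop :=
  T.adj u v ∧ pos θ v < pos θ u

/-- `x` lies strictly between two elements of `L` under the ordering `θ`. -/
def BetweenSet (θ : Equiv.Perm (Fin n)) (L : Finset (Fin n)) (x : Fin n) : Prop :=
  ∃ u ∈ L, ∃ w ∈ L, pos θ u < pos θ x ∧ pos θ x < pos θ w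

/-- The induced subtournament of `T` on `s` is transitive. -/
def IsTransOn (T : Tournament n) (s : Finset (Fin n)) : Prop :=
  ∀ u ∈ s, ∀ v ∈ s, ∀ w ∈ s, T.adj u v → T.adj v w → T.adj u w

/-- The largest size of a transitive subtournament of `T` contained in `s`. -/
noncomputable def trSizeOn (T : Tournament n) (s : Finset (Fin n)) : ℕ :=
  sSup {k | ∃ t, t ⊆ s ∧ T.IsTransOn t ∧ t.card = k}

/-- `tr(T)`: the largest size of a transitive subtournament of `T`. -/
noncomputable def trSize (T : Tournament n) : ℕ := T.trSizeOn Finset.univ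

/-- `T` contains `H`: some induced subtournament of `T` is isomorphic to `H`. -/
def Contains (T : Tournament N) (H : Tournament n) : Prop :=
  ∃ f : Fin n ↪ Fin N, ∀ u v, H.adj u v ↔ T.adj (f u) (f v)

/-- `T` is `ε`-critical. -/
def EpsCritical (T : Tournament n) (ε : ℝ) : Prop :=
  ((T.trSize : ℝ) < (n : ℝ) ^ ε) ∧
  ∀ s : Finset (Fin n), s ≠ Finset.univ → ((s.card : ℝ) ^ ε ≤ (T.trSizeOn s : ℝ))

/-- `S` with center `c` is a right star of `T` under `θ`. -/
def IsRightStarAt (T : Tournament n) (θ : Equiv.Perm (Fin n)) (S : Finset (Fin n))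
    (c : Fin n) : Prop :=
  c ∈ S ∧ (S.erase c).Nonempty ∧
  (∀ v ∈ S.erase c, pos θ v < pos θ c ∧ T.adj c v) ∧
  (∀ u ∈ S, ∀ v ∈ S, T.Backward θ u v → u = c)

/-- `S` with center `c` is a left star of `T` under `θ`. -/
def IsLeftStarAt (T : Tournament n) (θ : Equiv.Perm (Fin n)) (S : Finset (Fin n))
    (c : Fin n) : Prop :=
  c ∈ S ∧ (S.erase c).Nonempty ∧
  (∀ v ∈ S.erase c, pos θ c < pos θ v ∧ T.adj v c) ∧
  (∀ u ∈ S, ∀ v ∈ S, T.Backward θ u v → v = c)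

/-- `S` with center `c` is a middle star of `T` under `θ`. -/
def IsMiddleStarAt (T : Tournament n) (θ : Equiv.Perm (Fin n)) (S : Finset (Fin n))
    (c : Fin n) : Prop :=
  c ∈ S ∧
  (∃ v ∈ S.erase c, pos θ v < pos θ c) ∧ (∃ v ∈ S.erase c, pos θ c < pos θ v) ∧
  (∀ v ∈ S.erase c, (pos θ v < pos θ c → T.adj c v) ∧ (pos θ c < pos θ v → T.adj v c)) ∧
  (∀ u ∈ S, ∀ v ∈ S, T.Backward θ u v → u = c ∨ v = c)

def IsFrontierStarAt (T : Tournament n) (θ : Equiv.Perm (Fin n)) (S : Finset (Fin n))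
    (c : Fin n) : Prop :=
  T.IsLeftStarAt θ S c ∨ T.IsRightStarAt θ S c

def IsStarAt (T : Tournament n) (θ : Equiv.Perm (Fin n)) (S : Finset (Fin n))
    (c : Fin n) : Prop :=
  T.IsLeftStarAt θ S c ∨ T.IsRightStarAt θ S c ∨ T.IsMiddleStarAt θ S c

/-- A middle star with exactly one leaf after the center (center is `u_{p-1}`). -/
def IsOneRightMiddleStarAt (T : Tournament n) (θ : Equiv.Perm (Fin n)) (S : Finset (Fin n))
    (c : Fin n) : Prop :=
  T.IsMiddleStarAt θ S c ∧ ((S.erase c).filter (fun v => pos θ c < pos θ v)).card = 1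

/-- A middle star with exactly one leaf before the center (center is `u_2`). -/
def IsOneLeftMiddleStarAt (T : Tournament n) (θ : Equiv.Perm (Fin n)) (S : Finset (Fin n))
    (c : Fin n) : Prop :=
  T.IsMiddleStarAt θ S c ∧ ((S.erase c).filter (fun v => pos θ v < pos θ c)).card = 1

/-- Kinds of super 2-nebulas. -/
inductive NebKind
  | left
  | middle
  | right

/-- Common requirements on the data of a super 2-nebula: vertex set `S`, centers `c₁, c₂`
(`c₁` before `c₂` under `θ`), leaves `L₁` incident to `c₁` and `L₂` incident to `c₂`. -/
def Super2NebCommon (θ : Equiv.Perm (Fin n)) (S : Finset (Fin n)) (c₁ c₂ : Fin n)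
    (L₁ L₂ : Finset (Fin n)) : Prop :=
  L₁.Nonempty ∧ L₂.Nonempty ∧ Disjoint L₁ L₂ ∧
  c₁ ∉ L₁ ∪ L₂ ∧ c₂ ∉ L₁ ∪ L₂ ∧ c₁ ≠ c₂ ∧
  S = insert c₁ (insert c₂ (L₁ ∪ L₂)) ∧ pos θ c₁ < pos θ c₂

/-- `S` is a super (left/middle/right) 2-nebula of `T` under `θ`, with centers `c₁, c₂` and
leaves `L₁` (incident to `c₁`) and `L₂` (incident to `c₂`). -/
def IsSuper2NebulaAt (T : Tournament n) (θ : Equiv.Perm (Fin n)) (S : Finset (Fin n))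
    (c₁ c₂ : Fin n) (L₁ L₂ : Finset (Fin n)) : NebKind → Prop
  | NebKind.middle =>
      Super2NebCommon θ S c₁ c₂ L₁ L₂ ∧
      (∀ v ∈ L₁ ∪ L₂, pos θ c₁ < pos θ v ∧ pos θ v < pos θ c₂) ∧
      (∀ v ∈ L₁, T.adj v c₁) ∧ (∀ v ∈ L₂, T.adj c₂ v) ∧ T.adj c₂ c₁ ∧
      (∀ u ∈ S, ∀ v ∈ S, T.Backward θ u v →
        (u ∈ L₁ ∧ v = c₁) ∨ (u = c₂ ∧ v ∈ L₂) ∨ (u = c₂ ∧ v = c₁))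
  | NebKind.left =>
      Super2NebCommon θ S c₁ c₂ L₁ L₂ ∧
      (∀ v ∈ L₁ ∪ L₂, pos θ v < pos θ c₁) ∧
      (∀ v ∈ L₁, T.adj c₁ v) ∧ (∀ v ∈ L₂, T.adj c₂ v) ∧ T.adj c₂ c₁ ∧
      (∀ u ∈ S, ∀ v ∈ S, T.Backward θ u v →
        (u = c₁ ∧ v ∈ L₁) ∨ (u = c₂ ∧ v ∈ L₂) ∨ (u = c₂ ∧ v = c₁))
  | NebKind.right =>
      Super2NebCommon θ S c₁ c₂ L₁ L₂ ∧
      (∀ v ∈ L₁ ∪ L₂, pos θ c₂ < pos θ v) ∧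
      (∀ v ∈ L₁, T.adj v c₁) ∧ (∀ v ∈ L₂, T.adj v c₂) ∧ T.adj c₂ c₁ ∧
      (∀ u ∈ S, ∀ v ∈ S, T.Backward θ u v →
        (u ∈ L₁ ∧ v = c₁) ∨ (u ∈ L₂ ∧ v = c₂) ∨ (u = c₂ ∧ v = c₁))

/-- A decomposition of `T` witnessing that `T` is a super nebula under `θ`, with stars
`Q i` (centers `ctr i`) and super 2-nebulas `Sig i` (centers `c₁ i, c₂ i`, leaves
`L₁ i, L₂ i`, of kind `kd i`). -/
def SuperNebulaDecomp (T : Tournament n) (θ : Equiv.Perm (Fin n)) {m l : ℕ}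
    (Q : Fin m → Finset (Fin n)) (ctr : Fin m → Fin n)
    (Sig : Fin l → Finset (Fin n)) (c₁ c₂ : Fin l → Fin n)
    (L₁ L₂ : Fin l → Finset (Fin n)) (kd : Fin l → NebKind) : Prop :=
  (∀ i, T.IsStarAt θ (Q i) (ctr i)) ∧
  (∀ i, T.IsSuper2NebulaAt θ (Sig i) (c₁ i) (c₂ i) (L₁ i) (L₂ i) (kd i)) ∧
  (∀ i j, i ≠ j → Disjoint (Q i) (Q j)) ∧
  (∀ i j, i ≠ j → Disjoint (Sig i) (Sig j)) ∧
  (∀ i j, Disjoint (Q i) (Sig j)) ∧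
  (∀ u v, T.Backward θ u v → (∃ i, u ∈ Q i ∧ v ∈ Q i) ∨ (∃ i, u ∈ Sig i ∧ v ∈ Sig i)) ∧
  (∀ i j, ¬ BetweenSet θ (L₁ j ∪ L₂ j) (ctr i)) ∧
  (∀ i j, i ≠ j → ¬ BetweenSet θ (L₁ j ∪ L₂ j) (c₁ i) ∧ ¬ BetweenSet θ (L₁ j ∪ L₂ j) (c₂ i))

/-- `T` is a super nebula. -/
def IsSuperNebula (T : Tournament n) : Prop :=
  ∃ (θ : Equiv.Perm (Fin n)) (m l : ℕ) (Q : Fin m → Finset (Fin n)) (ctr : Fin m → Fin n)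
    (Sig : Fin l → Finset (Fin n)) (c₁ c₂ : Fin l → Fin n)
    (L₁ L₂ : Fin l → Finset (Fin n)) (kd : Fin l → NebKind),
    SuperNebulaDecomp T θ Q ctr Sig c₁ c₂ L₁ L₂ kd

/-- `{a, b, c}` (in this position order) is a triangle of `T` under `θ`:
`a` is the left exterior, `b` the center, `c` the right exterior. -/
def IsTriangleAt (T : Tournament n) (θ : Equiv.Perm (Fin n)) (a b c : Fin n) : Prop :=
  pos θ a < pos θ b ∧ pos θ b < pos θ c ∧ T.adj b a ∧ T.adj c a ∧ T.adj c b

/-- A decomposition of `T` under `θ` into triangles `{A i, B i, C i}` (left exterior, center,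
right exterior) and frontier stars `Q j` with centers `ctr j`, where for each triangle `i`,
the vertices in `forb i` are not allowed to lie between leaves of a star. -/
def TriGalaxyDecomp (T : Tournament n) (θ : Equiv.Perm (Fin n)) {l k : ℕ}
    (A B C : Fin l → Fin n) (Q : Fin k → Finset (Fin n)) (ctr : Fin k → Fin n)
    (forb : Fin l → Finset (Fin n)) : Prop :=
  (∀ i, T.IsTriangleAt θ (A i) (B i) (C i)) ∧
  (∀ j, T.IsFrontierStarAt θ (Q j) (ctr j)) ∧
  (∀ i j, i ≠ j →
    Disjoint ({A i, B i, C i} : Finset (Fin n)) ({A j, B j, C j} : Finset (Fin n))) ∧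
  (∀ i j, Disjoint ({A i, B i, C i} : Finset (Fin n)) (Q j)) ∧
  (∀ i j, i ≠ j → Disjoint (Q i) (Q j)) ∧
  (∀ u v, T.Backward θ u v →
    (∃ i, u ∈ ({A i, B i, C i} : Finset (Fin n)) ∧ v ∈ ({A i, B i, C i} : Finset (Fin n))) ∨
    (∃ j, u ∈ Q j ∧ v ∈ Q j)) ∧
  (∀ i j, i ≠ j → ¬ BetweenSet θ ((Q j).erase (ctr j)) (ctr i)) ∧
  (∀ i j, ∀ x ∈ forb i, ¬ BetweenSet θ ((Q j).erase (ctr j)) x)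

/-- `T` is a Δgalaxy: a triangular galaxy with exactly one triangle. -/
def IsDeltaGalaxy (T : Tournament n) : Prop :=
  ∃ (θ : Equiv.Perm (Fin n)) (a b c : Fin n) (k : ℕ)
    (Q : Fin k → Finset (Fin n)) (ctr : Fin k → Fin n),
    TriGalaxyDecomp T θ (fun _ : Fin 1 => a) (fun _ => b) (fun _ => c) Q ctr
      (fun _ => ({a, b, c} : Finset (Fin n)))

/-- `T` is a central triangular galaxy: centers of triangles may lie between leaves of stars. -/
def IsCentralTriangularGalaxy (T : Tournament n) : Prop :=
  ∃ (θ : Equiv.Perm (Fin n)) (l k : ℕ) (A B C : Fin l → Fin n)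
    (Q : Fin k → Finset (Fin n)) (ctr : Fin k → Fin n),
    TriGalaxyDecomp T θ A B C Q ctr (fun i => ({A i, C i} : Finset (Fin n)))

/-- `T` is a left triangular galaxy: left exteriors of triangles may lie between leaves. -/
def IsLeftTriangularGalaxy (T : Tournament n) : Prop :=
  ∃ (θ : Equiv.Perm (Fin n)) (l k : ℕ) (A B C : Fin l → Fin n)
    (Q : Fin k → Finset (Fin n)) (ctr : Fin k → Fin n),
    TriGalaxyDecomp T θ A B C Q ctr (fun i => ({B i, C i} : Finset (Fin n)))

/-- `T` is a right triangular galaxy: right exteriors of triangles may lie between leaves. -/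
def IsRightTriangularGalaxy (T : Tournament n) : Prop :=
  ∃ (θ : Equiv.Perm (Fin n)) (l k : ℕ) (A B C : Fin l → Fin n)
    (Q : Fin k → Finset (Fin n)) (ctr : Fin k → Fin n),
    TriGalaxyDecomp T θ A B C Q ctr (fun i => ({A i, B i} : Finset (Fin n)))

/-- A decomposition of `T` witnessing that `T` is a nebula under `θ` (no condition on the
location of the centers of the stars). -/
def NebulaDecomp (T : Tournament n) (θ : Equiv.Perm (Fin n)) {k : ℕ}
    (Q : Fin k → Finset (Fin n)) (ctr : Fin k → Fin n) : Prop :=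
  (∀ i, T.IsStarAt θ (Q i) (ctr i)) ∧
  (∀ i j, i ≠ j → Disjoint (Q i) (Q j)) ∧
  (∀ u v, T.Backward θ u v → ∃ i, u ∈ Q i ∧ v ∈ Q i)

/-- `T` is a central nebula: a nebula all of whose stars are 3-vertex middle stars. -/
def IsCentralNebula (T : Tournament n) : Prop :=
  ∃ (θ : Equiv.Perm (Fin n)) (k : ℕ) (Q : Fin k → Finset (Fin n)) (ctr : Fin k → Fin n),
    NebulaDecomp T θ Q ctr ∧ ∀ i, T.IsMiddleStarAt θ (Q i) (ctr i) ∧ (Q i).card = 3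

/-- `T` is a super left nebula: a nebula all of whose stars are left stars. -/
def IsSuperLeftNebula (T : Tournament n) : Prop :=
  ∃ (θ : Equiv.Perm (Fin n)) (k : ℕ) (Q : Fin k → Finset (Fin n)) (ctr : Fin k → Fin n),
    NebulaDecomp T θ Q ctr ∧ ∀ i, T.IsLeftStarAt θ (Q i) (ctr i)

/-- `T` is a super right nebula: a nebula all of whose stars are right stars. -/
def IsSuperRightNebula (T : Tournament n) : Prop :=
  ∃ (θ : Equiv.Perm (Fin n)) (k : ℕ) (Q : Fin k → Finset (Fin n)) (ctr : Fin k → Fin n),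
    NebulaDecomp T θ Q ctr ∧ ∀ i, T.IsRightStarAt θ (Q i) (ctr i)

/-- `T` is an LR-Δgalaxy: a super Δgalaxy in which only the two exteriors of the triangle
may lie between leaves of a star. -/
def IsLRDeltaGalaxy (T : Tournament n) : Prop :=
  ∃ (θ : Equiv.Perm (Fin n)) (a b c : Fin n) (k : ℕ)
    (Q : Fin k → Finset (Fin n)) (ctr : Fin k → Fin n),
    TriGalaxyDecomp T θ (fun _ : Fin 1 => a) (fun _ => b) (fun _ => c) Q ctr
      (fun _ => ({b} : Finset (Fin n)))

/-- `T` is a CR-Δgalaxy. -/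
def IsCRDeltaGalaxy (T : Tournament n) : Prop :=
  ∃ (θ : Equiv.Perm (Fin n)) (a b c : Fin n) (k : ℕ)
    (Q : Fin k → Finset (Fin n)) (ctr : Fin k → Fin n),
    TriGalaxyDecomp T θ (fun _ : Fin 1 => a) (fun _ => b) (fun _ => c) Q ctr
      (fun _ => ({a} : Finset (Fin n))) ∧
    (∀ i j, i ≠ j → BetweenSet θ ((Q i).erase (ctr i)) b →
      BetweenSet θ ((Q j).erase (ctr j)) c →
      (∀ x ∈ (Q i).erase (ctr i), ¬ BetweenSet θ ((Q j).erase (ctr j)) x) ∧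
      (∀ x ∈ (Q j).erase (ctr j), ¬ BetweenSet θ ((Q i).erase (ctr i)) x)) ∧
    (∀ i, BetweenSet θ ((Q i).erase (ctr i)) b → ¬ BetweenSet θ ((Q i).erase (ctr i)) c)

/-- `T` is a CL-Δgalaxy. -/
def IsCLDeltaGalaxy (T : Tournament n) : Prop :=
  ∃ (θ : Equiv.Perm (Fin n)) (a b c : Fin n) (k : ℕ)
    (Q : Fin k → Finset (Fin n)) (ctr : Fin k → Fin n),
    TriGalaxyDecomp T θ (fun _ : Fin 1 => a) (fun _ => b) (fun _ => c) Q ctr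
      (fun _ => ({c} : Finset (Fin n))) ∧
    (∀ i j, i ≠ j → BetweenSet θ ((Q i).erase (ctr i)) b →
      BetweenSet θ ((Q j).erase (ctr j)) a →
      (∀ x ∈ (Q i).erase (ctr i), ¬ BetweenSet θ ((Q j).erase (ctr j)) x) ∧
      (∀ x ∈ (Q j).erase (ctr j), ¬ BetweenSet θ ((Q i).erase (ctr i)) x)) ∧
    (∀ i, BetweenSet θ ((Q i).erase (ctr i)) b → ¬ BetweenSet θ ((Q i).erase (ctr i)) a)

/-- A decomposition of `T` under `θ` into one super 2-nebula (of kind `kd`) and frontier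
stars, covering all of `V(T)`, witnessing that `T` is a Σ-galaxy under `θ`. -/
def SigmaGalaxyDecomp (T : Tournament n) (θ : Equiv.Perm (Fin n))
    (S : Finset (Fin n)) (c₁ c₂ : Fin n) (L₁ L₂ : Finset (Fin n)) (kd : NebKind)
    {m : ℕ} (Q : Fin m → Finset (Fin n)) (ctr : Fin m → Fin n) : Prop :=
  T.IsSuper2NebulaAt θ S c₁ c₂ L₁ L₂ kd ∧
  (∀ j, T.IsFrontierStarAt θ (Q j) (ctr j)) ∧
  (∀ i j, i ≠ j → Disjoint (Q i) (Q j)) ∧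
  (∀ j, Disjoint S (Q j)) ∧
  (∀ v, v ∈ S ∨ ∃ j, v ∈ Q j) ∧
  (∀ u v, T.Backward θ u v → (u ∈ S ∧ v ∈ S) ∨ ∃ j, u ∈ Q j ∧ v ∈ Q j) ∧
  (∀ j, ¬ BetweenSet θ (L₁ ∪ L₂) (ctr j)) ∧
  (∀ j, ¬ BetweenSet θ ((Q j).erase (ctr j)) c₁ ∧ ¬ BetweenSet θ ((Q j).erase (ctr j)) c₂) ∧
  (∀ i j, i ≠ j → ¬ BetweenSet θ ((Q j).erase (ctr j)) (ctr i))

def IsMiddleSigmaGalaxy (T : Tournament n) : Prop :=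
  ∃ (θ : Equiv.Perm (Fin n)) (S : Finset (Fin n)) (c₁ c₂ : Fin n) (L₁ L₂ : Finset (Fin n))
    (m : ℕ) (Q : Fin m → Finset (Fin n)) (ctr : Fin m → Fin n),
    SigmaGalaxyDecomp T θ S c₁ c₂ L₁ L₂ NebKind.middle Q ctr

def IsLeftSigmaGalaxy (T : Tournament n) : Prop :=
  ∃ (θ : Equiv.Perm (Fin n)) (S : Finset (Fin n)) (c₁ c₂ : Fin n) (L₁ L₂ : Finset (Fin n))
    (m : ℕ) (Q : Fin m → Finset (Fin n)) (ctr : Fin m → Fin n),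
    SigmaGalaxyDecomp T θ S c₁ c₂ L₁ L₂ NebKind.left Q ctr

def IsRightSigmaGalaxy (T : Tournament n) : Prop :=
  ∃ (θ : Equiv.Perm (Fin n)) (S : Finset (Fin n)) (c₁ c₂ : Fin n) (L₁ L₂ : Finset (Fin n))
    (m : ℕ) (Q : Fin m → Finset (Fin n)) (ctr : Fin m → Fin n),
    SigmaGalaxyDecomp T θ S c₁ c₂ L₁ L₂ NebKind.right Q ctr

/-- The directed density from `X` to `Y`. -/
noncomputable def density (T : Tournament n) (X Y : Finset (Fin n)) : ℝ :=
  (Set.ncard {p : Fin n × Fin n | p.1 ∈ X ∧ p.2 ∈ Y ∧ T.adj p.1 p.2} : ℝ) /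
    ((X.card : ℝ) * (Y.card : ℝ))

/-- `(S i)` is a smooth `(c, lam, w)`-structure of `T`. -/
def IsSmoothStructure (T : Tournament n) (c lam : ℝ) {N : ℕ} (w : Fin N → Bool)
    (S : Fin N → Finset (Fin n)) : Prop :=
  (∀ i j, i ≠ j → Disjoint (S i) (S j)) ∧
  (∀ i, w i = false → c * (n : ℝ) ≤ ((S i).card : ℝ)) ∧
  (∀ i, w i = true → T.IsTransOn (S i) ∧ c * (T.trSize : ℝ) ≤ ((S i).card : ℝ)) ∧
  (∀ i j, i < j →
    (∀ v ∈ S i, 1 - lam ≤ T.density {v} (S j)) ∧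
    (∀ v ∈ S j, 1 - lam ≤ T.density (S i) {v}))

end Tournament

/-- The backward arcs of `K₆` under its canonical ordering. -/
def K6back : List (ℕ × ℕ) := [(3, 0), (5, 2), (5, 0), (4, 1)]

/-- The tournament `K₆`, on `Fin 6` with its canonical ordering. -/
def K6 : Tournament 6 where
  adj u v := (u.val, v.val) ∈ K6back ∨ (u < v ∧ (v.val, u.val) ∉ K6back)
  asymm := by decide
  total := by decide

/-- The pair `{H₁, H₂}` satisfies the Erdős–Hajnal conjecture: there is `ε > 0` such that
every `{H₁, H₂}`-free tournament `T` has a transitive subtournament of size `≥ |T| ^ ε`. -/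
def EHPair {n₁ n₂ : ℕ} (H₁ : Tournament n₁) (H₂ : Tournament n₂) : Prop :=
  ∃ ε : ℝ, 0 < ε ∧ ∀ (n : ℕ) (T : Tournament n),
    ¬ T.Contains H₁ → ¬ T.Contains H₂ → (n : ℝ) ^ ε ≤ (T.trSize : ℝ)

open Tournament

namespace Tournament

section Structure

open scoped Classical

variable {n : ℕ} {ι : Type*} [LinearOrder ι]

lemma adj_irrefl (T : Tournament n) (u : Fin n) : ¬ T.adj u u := fun h => T.asymm u u h h

lemma adj_of_not_adj (T : Tournament n) {u v : Fin n} (hne : u ≠ v) (h : ¬ T.adj v u) :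
    T.adj u v :=
  (T.total u v hne).resolve_right h

lemma contains_of_hom {h : ℕ} (T : Tournament n) (H : Tournament h) (f : Fin h → Fin n)
    (hf : ∀ x y, H.adj x y → T.adj (f x) (f y)) : T.Contains H := by
  have hinj : Function.Injective f := by
    intro x y hxy
    by_contra hne
    rcases H.total x y hne with h | h
    · exact T.adj_irrefl (f y) (hxy ▸ hf x y h)
    · exact T.adj_irrefl (f y) (hxy ▸ hf y x h)
  refine ⟨⟨f, hinj⟩, fun x y => ⟨hf x y, fun hT => ?_⟩⟩
  refine H.adj_of_not_adj (fun hxy => ?_) (fun hH => T.asymm _ _ hT (hf y x hH))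
  subst hxy
  exact T.adj_irrefl _ hT

/-- The arc joining `v` (placed at `x`) and `u` (placed at `y`) points forward. -/
def Fwd (T : Tournament n) (x y : ι) (v u : Fin n) : Prop :=
  (x < y → T.adj v u) ∧ (y < x → T.adj u v)

lemma fwd_comm {T : Tournament n} {x y : ι} {v u : Fin n} :
    T.Fwd x y v u ↔ T.Fwd y x u v := and_comm

lemma exists_subset_forall {κ β : Type*} (A : Finset β) (Y : Finset κ) (P : κ → β → Prop)
    (b : ℝ) (h : ∀ y ∈ Y, ((A.filter fun u => ¬ P y u).card : ℝ) ≤ b) :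
    ∃ B ⊆ A, (∀ u ∈ B, ∀ y ∈ Y, P y u) ∧ (A.card : ℝ) - Y.card * b ≤ B.card := by
  refine ⟨A.filter fun u => ∀ y ∈ Y, P y u, filter_subset _ _,
    fun u hu => (mem_filter.1 hu).2, ?_⟩
  have hsub : A ⊆ (A.filter fun u => ∀ y ∈ Y, P y u) ∪
      Y.biUnion fun y => A.filter fun u => ¬ P y u := by
    intro u hu
    by_cases hP : ∀ y ∈ Y, P y u
    · exact mem_union_left _ (mem_filter.2 ⟨hu, hP⟩)
    · push Not at hP
      obtain ⟨y, hy, hPy⟩ := hP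
      exact mem_union_right _ (mem_biUnion.2 ⟨y, hy, by simp [hu, hPy]⟩)
  have h1 := (card_le_card hsub).trans (card_union_le _ _)
  have h2 : ((Y.biUnion fun y => A.filter fun u => ¬ P y u).card : ℝ) ≤ Y.card * b := by
    calc ((Y.biUnion fun y => A.filter fun u => ¬ P y u).card : ℝ)
        ≤ ∑ y ∈ Y, ((A.filter fun u => ¬ P y u).card : ℝ) := by
          exact_mod_cast card_biUnion_le
      _ ≤ ∑ _y ∈ Y, b := sum_le_sum h
      _ = Y.card * b := by simp
  have h3 : (A.card : ℝ) ≤ ((A.filter fun u => ∀ y ∈ Y, P y u).card : ℝ) +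
      ((Y.biUnion fun y => A.filter fun u => ¬ P y u).card : ℝ) := by exact_mod_cast h1
  linarith

lemma exists_pieces {β : Type*} (A : Finset β) (r : β → β → Prop)
    (hirr : ∀ u ∈ A, ¬ r u u)
    (htrans : ∀ u ∈ A, ∀ v ∈ A, ∀ w ∈ A, r u v → r v w → r u w)
    (htot : ∀ u ∈ A, ∀ v ∈ A, u ≠ v → r u v ∨ r v u)
    {R : ℕ} (hR : 0 < R) (hRA : R ≤ A.card) :
    ∃ P : Fin R → Finset β, (∀ i, P i ⊆ A ∧ A.card ≤ 2 * R * (P i).card) ∧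
      ∀ i j, i < j → ∀ u ∈ P i, ∀ v ∈ P j, r u v := by
  set ρ : β → ℕ := fun v => (A.filter fun u => r u v).card with hρ
  have hmono : ∀ u ∈ A, ∀ v ∈ A, r u v → ρ u < ρ v := by
    intro u hu v hv huv
    refine card_lt_card ⟨?_, ?_⟩
    · intro w hw
      rw [mem_filter] at hw ⊢
      exact ⟨hw.1, htrans w hw.1 u hu v hv hw.2 huv⟩
    · intro hsub
      have : u ∈ A.filter fun w => r w u := hsub (by simp [hu, huv])
      exact hirr u hu (mem_filter.1 this).2
  have hinj : Set.InjOn ρ A := by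
    intro u hu v hv huv
    by_contra hne
    rcases htot u hu v hv hne with h | h
    · exact absurd (hmono u hu v hv h) (by omega)
    · exact absurd (hmono v hv u hu h) (by omega)
  have himg : A.image ρ = range A.card := by
    refine eq_of_subset_of_card_le ?_ ?_
    · intro k hk
      obtain ⟨v, hv, rfl⟩ := mem_image.1 hk
      rw [mem_range]
      refine card_lt_card ⟨filter_subset _ _, fun hsub => ?_⟩
      exact hirr v hv (mem_filter.1 (hsub hv)).2
    · rw [card_image_of_injOn hinj, card_range]
  set q := A.card / R with hq
  have hq1 : 1 ≤ q := (Nat.one_le_div_iff hR).2 hRA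
  refine ⟨fun i => A.filter fun v => ρ v ∈ Ico (i.val * q) ((i.val + 1) * q), ?_, ?_⟩
  · intro i
    refine ⟨filter_subset _ _, ?_⟩
    have hc : (A.filter fun v => ρ v ∈ Ico (i.val * q) ((i.val + 1) * q)).card = q := by
      rw [← card_image_of_injOn (hinj.mono fun v hv => (mem_filter.1 hv).1),
        show (A.filter fun v => ρ v ∈ Ico (i.val * q) ((i.val + 1) * q)).image ρ =
          Ico (i.val * q) ((i.val + 1) * q) from ?_]
      · rw [Nat.card_Ico, add_mul, one_mul, Nat.add_sub_cancel_left]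
      · ext k
        simp only [mem_image, mem_filter]
        constructor
        · rintro ⟨v, ⟨_, hv⟩, rfl⟩
          exact hv
        · intro hk
          have : k ∈ A.image ρ := by
            rw [himg, mem_range]
            have h1 := (mem_Ico.1 hk).2
            have h2 : (i.val + 1) * q ≤ R * q := Nat.mul_le_mul_right _ i.2
            have h3 : R * q ≤ A.card := Nat.mul_div_le _ _
            omega
          obtain ⟨v, hv, rfl⟩ := mem_image.1 this
          exact ⟨v, ⟨hv, hk⟩, rfl⟩
    rw [hc]
    have h1 : A.card < R * (q + 1) := by
      rw [mul_add, mul_one]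
      exact Nat.lt_mul_div_succ _ hR |>.trans_eq (by rw [← hq]; ring)
    nlinarith
  · intro i j hij u hu v hv
    rw [mem_filter, mem_Ico] at hu hv
    have h1 : (i.val + 1) * q ≤ j.val * q := Nat.mul_le_mul_right _ hij
    have h2 : ρ u < ρ v := by omega
    rcases htot u hu.1 v hv.1 (by rintro rfl; omega) with h | h
    · exact h
    · exact absurd (hmono v hv.1 u hu.1 h) (by omega)

lemma bddAbove_trans (T : Tournament n) (s : Finset (Fin n)) :
    BddAbove {k | ∃ t, t ⊆ s ∧ T.IsTransOn t ∧ t.card = k} :=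
  ⟨s.card, by rintro k ⟨t, ht, -, rfl⟩; exact card_le_card ht⟩

lemma card_le_trSizeOn (T : Tournament n) {t s : Finset (Fin n)} (hts : t ⊆ s)
    (ht : T.IsTransOn t) : t.card ≤ T.trSizeOn s :=
  le_csSup (T.bddAbove_trans s) ⟨t, hts, ht, rfl⟩

lemma exists_card_eq_trSizeOn (T : Tournament n) (s : Finset (Fin n)) :
    ∃ t, t ⊆ s ∧ T.IsTransOn t ∧ t.card = T.trSizeOn s :=
  Nat.sSup_mem (s := {k | ∃ t, t ⊆ s ∧ T.IsTransOn t ∧ t.card = k})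
    ⟨0, ∅, by simp, by simp [IsTransOn], rfl⟩ (T.bddAbove_trans s)

lemma IsTransOn.mono {T : Tournament n} {s t : Finset (Fin n)} (h : T.IsTransOn t)
    (hst : s ⊆ t) : T.IsTransOn s :=
  fun u hu v hv w hw => h u (hst hu) v (hst hv) w (hst hw)

lemma IsTransOn.union {T : Tournament n} {s t : Finset (Fin n)} (hs : T.IsTransOn s)
    (ht : T.IsTransOn t) (hst : ∀ u ∈ s, ∀ v ∈ t, T.adj u v) : T.IsTransOn (s ∪ t) := by
  intro u hu v hv w hw huv hvw
  rw [mem_union] at hu hv hw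
  rcases hu with hu | hu
  · rcases hw with hw | hw
    · rcases hv with hv | hv
      · exact hs u hu v hv w hw huv hvw
      · exact absurd hvw (T.asymm _ _ (hst w hw v hv))
    · exact hst u hu w hw
  · rcases hv with hv | hv
    · exact absurd huv (T.asymm _ _ (hst v hv u hu))
    · rcases hw with hw | hw
      · exact absurd hvw (T.asymm _ _ (hst w hw v hv))
      · exact ht u hu v hv w hw huv hvw

lemma trSizeOn_add_le (T : Tournament n) {X Y W : Finset (Fin n)} (hX : X ⊆ W) (hY : Y ⊆ W)
    (hXY : ∀ u ∈ X, ∀ v ∈ Y, T.adj u v) :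
    T.trSizeOn X + T.trSizeOn Y ≤ T.trSizeOn W := by
  obtain ⟨s, hsX, hs, hsc⟩ := T.exists_card_eq_trSizeOn X
  obtain ⟨t, htY, ht, htc⟩ := T.exists_card_eq_trSizeOn Y
  have hst : ∀ u ∈ s, ∀ v ∈ t, T.adj u v := fun u hu v hv => hXY u (hsX hu) v (htY hv)
  have hdisj : Disjoint s t :=
    disjoint_left.2 fun u hu hv => T.adj_irrefl u (hst u hu u hv)
  rw [← hsc, ← htc, ← card_union_of_disjoint hdisj]
  exact T.card_le_trSizeOn (union_subset (hsX.trans hX) (htY.trans hY)) (hs.union ht hst)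

lemma isTransOn_singleton (T : Tournament n) (v : Fin n) : T.IsTransOn {v} := by
  intro u hu w hw x hx h
  rw [mem_singleton] at hu hw
  subst hu hw
  exact absurd h (T.adj_irrefl _)

lemma exists_isTransOn_card (T : Tournament n) (m : ℕ) :
    ∀ A : Finset (Fin n), 2 ^ m ≤ A.card → ∃ X ⊆ A, T.IsTransOn X ∧ X.card = m + 1 := by
  induction m with
  | zero =>
    intro A hA
    obtain ⟨v, hv⟩ := card_pos.1 (by simpa using hA : 0 < A.card)
    exact ⟨{v}, by simpa using hv, T.isTransOn_singleton v, by simp⟩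
  | succ m ih =>
    intro A hA
    obtain ⟨v, hv⟩ := card_pos.1 ((by positivity : 0 < 2 ^ (m + 1)).trans_le hA)
    have hsub : A ⊆ insert v ((A.filter fun u => T.adj v u) ∪ A.filter fun u => T.adj u v) := by
      intro u hu
      by_cases huv : u = v
      · simp [huv]
      · rcases T.total u v huv with h | h <;> simp [hu, h]
    have h1 := (card_le_card hsub).trans (card_insert_le _ _)
    have h2 := card_union_le (A.filter fun u => T.adj v u) (A.filter fun u => T.adj u v)
    have h3 : 2 ^ (m + 1) = 2 ^ m + 2 ^ m := by ring
    by_cases h4 : 2 ^ m ≤ (A.filter fun u => T.adj v u).card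
    · obtain ⟨X, hXA, hX, hXc⟩ := ih _ h4
      have hvX : ∀ u ∈ X, T.adj v u := fun u hu => (mem_filter.1 (hXA hu)).2
      have hd : Disjoint {v} X := disjoint_singleton_left.2 fun h => T.adj_irrefl v (hvX v h)
      refine ⟨{v} ∪ X, union_subset (by simpa using hv) (hXA.trans (filter_subset _ _)),
        (T.isTransOn_singleton v).union hX (by simpa using hvX), ?_⟩
      rw [card_union_of_disjoint hd, card_singleton, hXc, add_comm]
    · obtain ⟨X, hXA, hX, hXc⟩ := ih (A.filter fun u => T.adj u v) (by omega)
      have hvX : ∀ u ∈ X, T.adj u v := fun u hu => (mem_filter.1 (hXA hu)).2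
      have hd : Disjoint X {v} := disjoint_singleton_right.2 fun h => T.adj_irrefl v (hvX v h)
      refine ⟨X ∪ {v}, union_subset (hXA.trans (filter_subset _ _)) (by simpa using hv),
        hX.union (T.isTransOn_singleton v) (by simpa using hvX), ?_⟩
      rw [card_union_of_disjoint hd, card_singleton, hXc]

/-- The number of pairs in `X × Y` that are not joined by an arc from `X` to `Y`. -/
noncomputable def nonArcs (T : Tournament n) (X Y : Finset (Fin n)) : ℕ :=
  ∑ v ∈ X, (Y.filter fun u => ¬ T.adj v u).card

lemma nonArcs_eq_sum_right (T : Tournament n) (X Y : Finset (Fin n)) :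
    T.nonArcs X Y = ∑ u ∈ Y, (X.filter fun v => ¬ T.adj v u).card :=
  sum_card_bipartiteAbove_eq_sum_card_bipartiteBelow (fun v u => ¬ T.adj v u)

lemma nonArcs_mono (T : Tournament n) {X X' Y Y' : Finset (Fin n)} (hX : X' ⊆ X) (hY : Y' ⊆ Y) :
    T.nonArcs X' Y' ≤ T.nonArcs X Y :=
  (sum_le_sum fun _ _ => card_le_card (filter_subset_filter _ hY)).trans
    (sum_le_sum_of_subset hX)

lemma exists_sparse_pair_aux {h : ℕ} (H : Tournament h) {lam : ℝ} (hlam : 0 < lam)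
    (hlam1 : lam ≤ 1) {m : ℝ} (hm : 0 ≤ m) (T : Tournament n) (V₀ : Fin h → Finset (Fin n))
    (hdisj : ∀ x y, x ≠ y → Disjoint (V₀ x) (V₀ y))
    (hsize : ∀ x, (h : ℝ) * m < lam ^ h * (V₀ x).card)
    (hno : ∀ x y, x ≠ y → ∀ X ⊆ V₀ x, ∀ Y ⊆ V₀ y, m ≤ X.card → m ≤ Y.card →
      lam * X.card * Y.card < (T.nonArcs X Y : ℝ))
    (D : Finset (Fin h)) :
    ∃ (f : Fin h → Fin n) (V : Fin h → Finset (Fin n)),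
      (∀ x, x ∉ D → V x ⊆ V₀ x ∧ lam ^ D.card * (V₀ x).card ≤ (V x).card) ∧
      (∀ x, x ∉ D → ∀ d ∈ D, ∀ u ∈ V x,
        (H.adj d x → T.adj (f d) u) ∧ (H.adj x d → T.adj u (f d))) ∧
      ∀ d ∈ D, ∀ e ∈ D, H.adj d e → T.adj (f d) (f e) := by
  induction D using Finset.induction_on with
  | empty =>
    by_cases hn : Nonempty (Fin n)
    · exact ⟨fun _ => hn.some, V₀, by simp⟩
    · refine ⟨fun x => absurd (hsize x) ?_, V₀, by simp⟩
      have : (V₀ x) = ∅ := by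
        rw [eq_empty_iff_forall_notMem]
        exact fun v _ => hn ⟨v⟩
      rw [this]
      simp only [card_empty, Nat.cast_zero, mul_zero, not_lt]
      positivity
  | insert x D hxD ih =>
    obtain ⟨f, V, hV, hfV, hf⟩ := ih
    have hDh : ∀ D' : Finset (Fin h), lam ^ h ≤ lam ^ D'.card := fun D' =>
      pow_le_pow_of_le_one hlam.le hlam1 (by simpa using card_le_univ D')
    have hVm : ∀ y, y ∉ D → (h : ℝ) * m < (V y).card := fun y hy =>
      (hsize y).trans_le ((mul_le_mul_of_nonneg_right (hDh D) (by positivity)).trans (hV y hy).2)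
    have hh : (1 : ℝ) ≤ h := by exact_mod_cast (Fin.pos x)
    let C : Fin h → Fin n → Fin n → Prop := fun y v u =>
      (H.adj x y → T.adj v u) ∧ (H.adj y x → T.adj u v)
    let P : Fin h → Fin n → Prop := fun y v =>
      lam * (V y).card ≤ (((V y).filter (C y v)).card : ℝ)
    obtain ⟨Y₀, hY₀⟩ : ∃ Y₀ : Finset (Fin h), ∀ y, y ∈ Y₀ ↔ y ∉ insert x D :=
      ⟨univ.filter fun y => y ∉ insert x D, by simp⟩
    have hbad : ∀ y ∈ Y₀,
        (((V x).filter fun v => ¬ P y v).card : ℝ) ≤ m := by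
      intro y hy
      rw [hY₀, mem_insert, not_or] at hy
      obtain ⟨hyx, hyD⟩ := hy
      by_contra hlt
      push Not at hlt
      set B := (V x).filter fun v => ¬ P y v with hB
      have hBx : B ⊆ V₀ x := (filter_subset _ _).trans (hV x hxD).1
      have hVy := (hV y hyD).1
      have hmy : m ≤ (V y).card := by nlinarith [hVm y hyD]
      have hBs : ∀ v ∈ B, (((V y).filter (C y v)).card : ℝ) ≤ lam * (V y).card := by
        intro v hv
        have := (mem_filter.1 hv).2
        simp only [P, not_le] at this
        exact this.le
      have hne : ∀ v ∈ B, ∀ u ∈ V y, v ≠ u := fun v hv u hu huv =>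
        disjoint_left.1 (hdisj x y (Ne.symm hyx)) (hBx hv) (hVy (huv ▸ hu))
      have hsum : (∑ v ∈ B, (((V y).filter (C y v)).card : ℝ)) ≤ lam * B.card * (V y).card := by
        refine (sum_le_sum hBs).trans_eq ?_
        rw [sum_const, nsmul_eq_mul]
        ring
      rcases H.total x y (Ne.symm hyx) with hxy | hxy
      · have h1 := hno y x hyx (V y) hVy B hBx hmy hlt.le
        have h2 : T.nonArcs (V y) B ≤ ∑ v ∈ B, ((V y).filter (C y v)).card := by
          rw [nonArcs_eq_sum_right]
          refine sum_le_sum fun v hv => card_le_card fun u hu => ?_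
          rw [mem_filter] at hu ⊢
          exact ⟨hu.1, fun _ => T.adj_of_not_adj (hne v hv u hu.1) hu.2,
            fun hc => absurd hc (H.asymm _ _ hxy)⟩
        have h3 : (T.nonArcs (V y) B : ℝ) ≤ ∑ v ∈ B, (((V y).filter (C y v)).card : ℝ) := by
          exact_mod_cast h2
        linarith [mul_right_comm lam (B.card : ℝ) ((V y).card : ℝ)]
      · have h1 := hno x y (Ne.symm hyx) B hBx (V y) hVy hlt.le hmy
        have h2 : T.nonArcs B (V y) ≤ ∑ v ∈ B, ((V y).filter (C y v)).card := by
          refine sum_le_sum fun v hv => card_le_card fun u hu => ?_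
          rw [mem_filter] at hu ⊢
          exact ⟨hu.1, fun hc => absurd hc (H.asymm _ _ hxy),
            fun _ => T.adj_of_not_adj (hne v hv u hu.1).symm hu.2⟩
        have h3 : (T.nonArcs B (V y) : ℝ) ≤ ∑ v ∈ B, (((V y).filter (C y v)).card : ℝ) := by
          exact_mod_cast h2
        linarith
    obtain ⟨B, hBV, hBP, hcount⟩ := exists_subset_forall (V x) _ P m hbad
    have hYc : (Y₀.card : ℝ) ≤ h := by
      exact_mod_cast (card_le_univ _).trans_eq (Fintype.card_fin h)
    have hpos := lt_of_lt_of_le (a := (0 : ℝ)) (by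
      have := hVm x hxD
      have := mul_le_mul_of_nonneg_right hYc hm
      linarith) hcount
    obtain ⟨v, hv⟩ := card_pos.1 (Nat.cast_pos.1 hpos)
    have hvV := hBV hv
    have hvP := hBP v hv
    refine ⟨Function.update f x v, fun y => (V y).filter (C y v), ?_, ?_, ?_⟩
    · intro y hy
      have hyD : y ∉ D := fun h => hy (mem_insert_of_mem h)
      refine ⟨(filter_subset _ _).trans (hV y hyD).1, ?_⟩
      refine le_trans ?_ (hvP y ((hY₀ y).2 hy))
      rw [card_insert_of_notMem hxD, pow_succ', mul_assoc]
      exact mul_le_mul_of_nonneg_left (hV y hyD).2 hlam.le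
    · intro y hy d hd u hu
      have hyD : y ∉ D := fun h => hy (mem_insert_of_mem h)
      rw [mem_filter] at hu
      by_cases hdx : d = x
      · subst hdx
        simpa using hu.2
      · rw [Function.update_of_ne hdx]
        exact hfV y hyD d (mem_of_mem_insert_of_ne hd hdx) u hu.1
    · intro d hd e he hde
      by_cases hdx : d = x <;> by_cases hex : e = x
      · subst hdx hex
        exact absurd hde (H.adj_irrefl _)
      · subst hdx
        rw [Function.update_self, Function.update_of_ne hex]
        exact (hfV d hxD e (mem_of_mem_insert_of_ne he hex) v hvV).2 hde
      · subst hex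
        rw [Function.update_self, Function.update_of_ne hdx]
        exact (hfV e hxD d (mem_of_mem_insert_of_ne hd hdx) v hvV).1 hde
      · rw [Function.update_of_ne hdx, Function.update_of_ne hex]
        exact hf d (mem_of_mem_insert_of_ne hd hdx) e (mem_of_mem_insert_of_ne he hex) hde

lemma exists_sparse_pair {h : ℕ} (H : Tournament h) {lam : ℝ} (hlam : 0 < lam)
    (hlam1 : lam ≤ 1) :
    ∃ c : ℝ, 0 < c ∧ c ≤ 1 ∧ ∀ (n : ℕ) (T : Tournament n), ¬ T.Contains H →
      ∀ A : Finset (Fin n), 1 ≤ c * A.card →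
      ∃ X ⊆ A, ∃ Y ⊆ A, Disjoint X Y ∧ c * A.card ≤ X.card ∧ c * A.card ≤ Y.card ∧
        (T.nonArcs X Y : ℝ) ≤ lam * X.card * Y.card := by
  set c : ℝ := lam ^ h / (2 * (h + 1) ^ 2) with hc
  have hpow : lam ^ h ≤ 1 := pow_le_one₀ hlam.le hlam1
  have hpow0 : 0 < lam ^ h := by positivity
  have hc0 : 0 < c := by positivity
  have hcle : c * (2 * (h + 1) ^ 2) = lam ^ h := div_mul_cancel₀ _ (by positivity)
  have hc1 : c ≤ 1 := by
    have : (1 : ℝ) ≤ 2 * (h + 1) ^ 2 := by nlinarith [(Nat.cast_nonneg h : (0 : ℝ) ≤ h)]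
    nlinarith
  refine ⟨c, hc0, hc1, fun n T hT A hA => ?_⟩
  have hh : 0 < h := by
    rcases Nat.eq_zero_or_pos h with rfl | hh
    · exact absurd (T.contains_of_hom H (fun x => x.elim0) fun x => x.elim0) hT
    · exact hh
  have hhr : (1 : ℝ) ≤ h := by exact_mod_cast hh
  have hA1 : (2 * (h + 1) ^ 2 : ℝ) ≤ A.card := by
    have : c * (2 * (h + 1) ^ 2) ≤ c * A.card := by linarith
    exact le_of_mul_le_mul_left this hc0
  obtain ⟨V₀, hV₀, hlt⟩ := exists_pieces A (fun u v => u < v) (fun u _ => lt_irrefl u)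
    (fun u _ v _ w _ => lt_trans) (fun u _ v _ => lt_or_gt_of_ne) hh
    (by have : (h : ℝ) ≤ A.card := by nlinarith
        exact_mod_cast this)
  by_contra hno
  push Not at hno
  have hdisj : ∀ x y, x ≠ y → Disjoint (V₀ x) (V₀ y) := by
    intro x y hxy
    rw [disjoint_left]
    intro u hu hu'
    rcases lt_or_gt_of_ne hxy with h | h
    · exact lt_irrefl u (hlt x y h u hu u hu')
    · exact lt_irrefl u (hlt y x h u hu' u hu)
  obtain ⟨f, V, -, -, hf⟩ := exists_sparse_pair_aux H hlam hlam1 (m := c * A.card) (by positivity)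
    T V₀ hdisj (by
      intro x
      have h1 : (A.card : ℝ) ≤ 2 * h * (V₀ x).card := by exact_mod_cast (hV₀ x).2
      rw [← hcle]
      have h2 : (0 : ℝ) < A.card := by nlinarith
      have h3 : (0 : ℝ) < (V₀ x).card := by
        by_contra hcon
        push Not at hcon
        nlinarith
      have h4 : c * (h * A.card) ≤ c * (2 * h ^ 2 * (V₀ x).card) :=
        mul_le_mul_of_nonneg_left (by nlinarith) hc0.le
      have h5 : (0 : ℝ) < c * (V₀ x).card := by positivity
      nlinarith) (by
      intro x y hxy X hX Y hY hXc hYc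
      exact hno X (hX.trans (hV₀ x).1) Y (hY.trans (hV₀ y).1)
        (disjoint_of_subset_left hX (disjoint_of_subset_right hY (hdisj x y hxy))) hXc hYc) univ
  exact hT (T.contains_of_hom H f fun x y => hf x (mem_univ x) y (mem_univ y))

lemma exists_sparse_chain {h : ℕ} (H : Tournament h) (M : ℕ) :
    ∀ lam : ℝ, 0 < lam → lam ≤ 1 → ∃ c : ℝ, 0 < c ∧ c ≤ 1 ∧
      ∀ (n : ℕ) (T : Tournament n), ¬ T.Contains H →
      ∀ A : Finset (Fin n), 1 ≤ c * A.card → ∃ S : ℕ → Finset (Fin n),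
        (∀ i < M, S i ⊆ A ∧ c * A.card ≤ (S i).card) ∧
        ∀ j < M, ∀ i < j, Disjoint (S i) (S j) ∧
          (T.nonArcs (S i) (S j) : ℝ) ≤ lam * (S i).card * (S j).card := by
  induction M with
  | zero => exact fun lam _ _ => ⟨1, one_pos, le_rfl, fun n T _ A _ => ⟨fun _ => ∅, by simp⟩⟩
  | succ M ih =>
    intro lam hlam hlam1
    obtain ⟨c₁, hc₁, hc₁1, hchain⟩ := ih lam hlam hlam1
    obtain ⟨c₂, hc₂, hc₂1, hpair⟩ := exists_sparse_pair H (lam := lam * c₁) (by positivity)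
      (by nlinarith)
    refine ⟨c₁ * c₂, by positivity, by nlinarith, fun n T hT A hA => ?_⟩
    have hA0 : (0 : ℝ) ≤ A.card := Nat.cast_nonneg _
    have hle : c₁ * c₂ * A.card ≤ c₂ * A.card := by
      rw [mul_assoc]
      exact mul_le_of_le_one_left (by positivity) hc₁1
    obtain ⟨X, hXA, Y, hYA, hXY, hXc, hYc, harcs⟩ := hpair n T hT A (hA.trans hle)
    have hY1 : c₁ * c₂ * A.card ≤ c₁ * Y.card := by
      rw [mul_assoc]
      exact mul_le_mul_of_nonneg_left hYc hc₁.le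
    obtain ⟨S, hS, hSS⟩ := hchain n T hT Y (hA.trans hY1)
    refine ⟨fun i => if i = 0 then X else S (i - 1), ?_, ?_⟩
    · intro i hi
      rcases Nat.eq_zero_or_pos i with rfl | hi0
      · exact ⟨by simpa using hXA, by simpa using hle.trans hXc⟩
      · have := hS (i - 1) (by omega)
        simp only [hi0.ne', if_false]
        exact ⟨this.1.trans hYA, hY1.trans this.2⟩
    · intro j hj i hij
      have hj0 : j ≠ 0 := by omega
      have hSj := hS (j - 1) (by omega)
      simp only [hj0, if_false]
      rcases Nat.eq_zero_or_pos i with rfl | hi0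
      · simp only [if_true]
        refine ⟨disjoint_of_subset_right hSj.1 hXY, ?_⟩
        calc (T.nonArcs X (S (j - 1)) : ℝ) ≤ T.nonArcs X Y := by
              exact_mod_cast T.nonArcs_mono subset_rfl hSj.1
          _ ≤ lam * X.card * (c₁ * Y.card) := by linarith
          _ ≤ lam * X.card * (S (j - 1)).card :=
              mul_le_mul_of_nonneg_left hSj.2 (by positivity)
      · simp only [hi0.ne', if_false]
        exact hSS (j - 1) (by omega) (i - 1) (by omega)

/-- The number of pairs in `X × Y`, with `X` placed at `x` and `Y` at `y`, not joined by a
forward arc. -/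
noncomputable def nonFwd (T : Tournament n) (x y : ι) (X Y : Finset (Fin n)) : ℕ :=
  ∑ v ∈ X, (Y.filter fun u => ¬ T.Fwd x y v u).card

lemma nonFwd_comm (T : Tournament n) (x y : ι) (X Y : Finset (Fin n)) :
    T.nonFwd x y X Y = T.nonFwd y x Y X := by
  refine (sum_card_bipartiteAbove_eq_sum_card_bipartiteBelow
    (fun v u => ¬ T.Fwd x y v u)).trans (sum_congr rfl fun u _ => ?_)
  simp only [bipartiteBelow, fwd_comm (x := x)]

lemma nonFwd_mono (T : Tournament n) (x y : ι) {X X' Y Y' : Finset (Fin n)} (hX : X' ⊆ X)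
    (hY : Y' ⊆ Y) : T.nonFwd x y X' Y' ≤ T.nonFwd x y X Y :=
  (sum_le_sum fun _ _ => card_le_card (filter_subset_filter _ hY)).trans
    (sum_le_sum_of_subset hX)

lemma nonFwd_eq_zero (T : Tournament n) {x y : ι} {X Y : Finset (Fin n)}
    (h : ∀ v ∈ X, ∀ u ∈ Y, T.Fwd x y v u) : T.nonFwd x y X Y = 0 := by
  refine sum_eq_zero fun v hv => ?_
  rw [card_eq_zero, filter_eq_empty_iff]
  exact fun u hu => not_not.2 (h v hv u hu)

lemma fwd_self (T : Tournament n) (x : ι) (v u : Fin n) : T.Fwd x x v u :=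
  ⟨fun h => absurd h (lt_irrefl x), fun h => absurd h (lt_irrefl x)⟩

lemma nonFwd_of_lt (T : Tournament n) {x y : ι} (hxy : x < y) (X Y : Finset (Fin n)) :
    T.nonFwd x y X Y = T.nonArcs X Y := by
  simp [nonFwd, nonArcs, Fwd, hxy, hxy.not_gt]

lemma exists_clean [Fintype ι] (T : Tournament n) (S : ι → Finset (Fin n)) {lam : ℝ}
    (hlam : 0 < lam)
    (hS : ∀ x y, (T.nonFwd x y (S x) (S y) : ℝ) ≤ lam * (S x).card * (S y).card) (x : ι) :
    ∃ B ⊆ S x, (S x).card ≤ 2 * B.card ∧ ∀ v ∈ B, ∀ y,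
      (((S y).filter fun u => ¬ T.Fwd x y v u).card : ℝ) ≤
        2 * Fintype.card ι * lam * (S y).card := by
  have hM : (0 : ℝ) < Fintype.card ι := by exact_mod_cast Fintype.card_pos_iff.2 ⟨x⟩
  obtain ⟨B, hBS, hB, hc⟩ := exists_subset_forall (S x) (univ : Finset ι)
    (fun y v => (((S y).filter fun u => ¬ T.Fwd x y v u).card : ℝ) ≤
        2 * Fintype.card ι * lam * (S y).card) ((S x).card / (2 * Fintype.card ι)) (by
      intro y _
      set Z := (S x).filter fun v => ¬ (((S y).filter fun u => ¬ T.Fwd x y v u).card : ℝ) ≤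
        2 * Fintype.card ι * lam * (S y).card with hZ
      rcases (S y).eq_empty_or_nonempty with hy | hy
      · have : Z = ∅ := by
          rw [hZ, filter_eq_empty_iff]
          simp [hy]
        rw [this]
        simp only [card_empty, Nat.cast_zero]
        positivity
      · have hy0 : (0 : ℝ) < (S y).card := by exact_mod_cast hy.card_pos
        have h1 : (Z.card : ℝ) * (2 * Fintype.card ι * lam * (S y).card) ≤
            lam * (S x).card * (S y).card := by
          refine le_trans ?_ ((Nat.cast_le.2 (T.nonFwd_mono x y (X' := Z)
            (filter_subset _ _) (subset_refl (S y)))).trans (hS x y))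
          rw [nonFwd, Nat.cast_sum, ← nsmul_eq_mul]
          refine card_nsmul_le_sum _ _ _ fun v hv => ?_
          exact (not_le.1 (mem_filter.1 hv).2).le
        rw [le_div_iff₀ (by positivity)]
        have h2 : (0 : ℝ) < lam * (S y).card := by positivity
        refine le_of_mul_le_mul_right ?_ h2
        linarith)
  refine ⟨B, hBS, ?_, fun v hv y => hB v hv y (mem_univ y)⟩
  have h1 : ((univ : Finset ι).card : ℝ) * ((S x).card / (2 * Fintype.card ι)) =
      (S x).card / 2 := by
    rw [card_univ]
    field_simp
  rw [h1] at hc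
  have : ((S x).card : ℝ) ≤ 2 * B.card := by linarith
  exact_mod_cast this

lemma exists_transitive_refinement [Fintype ι] (T : Tournament n) (S : ι → Finset (Fin n))
    {lam g : ℝ} (hlam : 0 < lam)
    (hS : ∀ x y, (T.nonFwd x y (S x) (S y) : ℝ) ≤ lam * (S x).card * (S y).card)
    (D : Finset ι)
    (htr : ∀ x ∈ D, ∀ B ⊆ S x, (S x).card ≤ 2 * B.card →
      ∃ X ⊆ B, T.IsTransOn X ∧ g ≤ X.card) :
    ∃ S' : ι → Finset (Fin n), (∀ x, S' x ⊆ S x) ∧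
      (∀ x ∈ D, T.IsTransOn (S' x) ∧ g ≤ (S' x).card) ∧ (∀ x, x ∉ D → S' x = S x) ∧
      ∀ x y, (T.nonFwd x y (S' x) (S' y) : ℝ) ≤
        (2 * Fintype.card ι) ^ D.card * lam * (S' x).card * (S' y).card := by
  induction D using Finset.induction_on with
  | empty => exact ⟨S, fun _ => subset_rfl, by simp, by simp, by simpa using hS⟩
  | insert x D hxD ih =>
    obtain ⟨S', hsub, hD, hnD, hS'⟩ := ih fun y hy => htr y (mem_insert_of_mem hy)
    have hM : (1 : ℝ) ≤ Fintype.card ι := by exact_mod_cast Fintype.card_pos_iff.2 ⟨x⟩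
    set mu : ℝ := (2 * Fintype.card ι) ^ D.card * lam with hmu
    have hmu0 : 0 < mu := by positivity
    obtain ⟨B, hBS, hBc, hB⟩ := T.exists_clean S' hmu0 hS' x
    rw [hnD x hxD] at hBS hBc
    obtain ⟨X, hXB, hX, hXg⟩ := htr x (mem_insert_self x D) B hBS hBc
    have hpow : (2 * Fintype.card ι : ℝ) ^ (insert x D).card * lam =
        2 * Fintype.card ι * mu := by
      rw [card_insert_of_notMem hxD, pow_succ', hmu, mul_assoc]
    have hXy : ∀ y, (T.nonFwd x y X (S' y) : ℝ) ≤
        2 * Fintype.card ι * mu * X.card * (S' y).card := by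
      intro y
      rw [nonFwd, Nat.cast_sum]
      refine (sum_le_card_nsmul _ _ _ fun v hv => hB v (hXB hv) y).trans_eq ?_
      rw [nsmul_eq_mul]
      ring
    refine ⟨Function.update S' x X, ?_, ?_, ?_, ?_⟩
    · intro y
      by_cases hy : y = x
      · subst hy
        simpa using hXB.trans hBS
      · simpa [hy] using hsub y
    · intro y hy
      by_cases hyx : y = x
      · subst hyx
        simpa using ⟨hX, hXg⟩
      · simpa [hyx] using hD y (mem_of_mem_insert_of_ne hy hyx)
    · intro y hy
      rw [mem_insert, not_or] at hy
      simpa [hy.1] using hnD y hy.2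
    · intro y z
      rw [hpow]
      by_cases hy : y = x <;> by_cases hz : z = x
      · subst hy hz
        rw [T.nonFwd_eq_zero fun v _ u _ => T.fwd_self z v u]
        simp only [Nat.cast_zero]
        positivity
      · subst hy
        simpa [hz] using hXy z
      · subst hz
        rw [nonFwd_comm]
        simpa [hy, mul_right_comm] using hXy y
      · simp only [Function.update_of_ne hy, Function.update_of_ne hz]
        refine (hS' y z).trans ?_
        have : mu ≤ 2 * Fintype.card ι * mu := by nlinarith
        gcongr

/-- A family of disjoint vertex sets indexed by the cells of a `K × R` grid, ordered
lexicographically, such that almost all arcs point forward, all arcs between distinct cells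
`(j, r)` and `(j, r')` with `r, r' ≠ 0` point forward, and there are backward arcs between
large subsets of any two cells one of which is of the form `(j, 0)`. -/
structure IsSmoothGrid (T : Tournament n) {K R : ℕ} (lam δ : ℝ)
    (S : Fin K ×ₗ Fin R → Finset (Fin n)) : Prop where
  nonempty : ∀ x, (S x).Nonempty
  disjoint : ∀ x y, x ≠ y → Disjoint (S x) (S y)
  smooth : ∀ x y, ∀ v ∈ S x,
    (((S y).filter fun u => ¬ T.Fwd x y v u).card : ℝ) ≤ lam * (S y).card
  fwd_of_level : ∀ x y, (ofLex x).1 = (ofLex y).1 → (ofLex x).2.val ≠ 0 →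
    (ofLex y).2.val ≠ 0 → ∀ v ∈ S x, ∀ u ∈ S y, T.Fwd x y v u
  crit : ∀ x y, x ≠ y → (ofLex x).2.val = 0 → ∀ X ⊆ S x, ∀ Y ⊆ S y,
    δ * (S x).card ≤ X.card → δ * (S y).card ≤ Y.card → ∃ v ∈ X, ∃ u ∈ Y, T.Fwd y x v u

lemma exists_small_exponent {β η C : ℝ} (hβ : 0 < β) (hη : 0 < η) (hC : 0 < C) :
    ∃ ε : ℝ, 0 < ε ∧ 1 - η < β ^ ε ∧ C ^ ε < 2 := by
  have h1 : Filter.Tendsto (fun x : ℝ => β ^ x) (nhds 0) (nhds 1) := by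
    simpa using (Real.continuousAt_const_rpow (b := 0) hβ.ne').tendsto
  have h2 : Filter.Tendsto (fun x : ℝ => C ^ x) (nhds 0) (nhds 1) := by
    simpa using (Real.continuousAt_const_rpow (b := 0) hC.ne').tendsto
  have h3 := (h1.eventually (lt_mem_nhds (by linarith : 1 - η < 1))).and
    (h2.eventually (gt_mem_nhds (by norm_num : (1 : ℝ) < 2)))
  have h4 : ∀ᶠ x : ℝ in nhdsWithin 0 (Set.Ioi 0), 1 - η < β ^ x ∧ C ^ x < 2 :=
    h3.filter_mono nhdsWithin_le_nhds
  obtain ⟨ε, hε, hε0⟩ := (h4.and self_mem_nhdsWithin).exists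
  exact ⟨ε, hε0, hε⟩

/-- Under the assumption that all proper subsets of `W` satisfy the conclusion with exponent
`ε` but `W` does not, `W` is large and its transitive subsets are large. -/
lemma critical_large (T : Tournament n) {ε C : ℝ} (hε : 0 < ε) (hC : C ^ ε < 2)
    {W : Finset (Fin n)} (hW : (T.trSizeOn W : ℝ) < (W.card : ℝ) ^ ε) :
    1 ≤ T.trSizeOn W ∧ C < W.card := by
  have hne : W.Nonempty := by
    rw [nonempty_iff_ne_empty]
    rintro rfl
    rw [card_empty, Nat.cast_zero, Real.zero_rpow hε.ne'] at hW
    exact absurd hW (not_lt.2 (Nat.cast_nonneg _))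
  obtain ⟨v, hv⟩ := hne
  have h1 : 1 ≤ T.trSizeOn W :=
    T.card_le_trSizeOn (t := {v}) (by simpa using hv) (T.isTransOn_singleton v)
  refine ⟨h1, ?_⟩
  have h2 : ∃ u ∈ W, u ≠ v := by
    by_contra hcon
    push Not at hcon
    have : W = {v} := eq_singleton_iff_unique_mem.2 ⟨hv, hcon⟩
    rw [this, card_singleton, Nat.cast_one, Real.one_rpow, ← this] at hW
    exact absurd hW (not_lt.2 (by exact_mod_cast h1))
  obtain ⟨u, hu, huv⟩ := h2
  have h3 : 2 ≤ T.trSizeOn W := by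
    have key : ∀ u v : Fin n, u ∈ W → v ∈ W → T.adj u v → 2 ≤ T.trSizeOn W := by
      intro u v hu hv huv
      have hne : u ≠ v := fun h => T.adj_irrefl v (h ▸ huv)
      rw [← card_pair hne]
      refine T.card_le_trSizeOn (by simp [insert_subset_iff, hu, hv]) ?_
      exact (T.isTransOn_singleton u).union (T.isTransOn_singleton v) (by simpa using huv)
    rcases T.total u v huv with h | h
    · exact key u v hu hv h
    · exact key v u hv hu h
  by_contra hcon
  push Not at hcon
  have h4 := Real.rpow_le_rpow (Nat.cast_nonneg _) hcon hε.le
  have h5 : (2 : ℝ) ≤ T.trSizeOn W := by exact_mod_cast h3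
  linarith

lemma grid_lt_iff {K R : ℕ} {x y : Fin K ×ₗ Fin R} :
    x < y ↔ (ofLex x).1.val < (ofLex y).1.val ∨ (ofLex x).1.val = (ofLex y).1.val ∧
      (ofLex x).2.val < (ofLex y).2.val := by
  rw [Prod.Lex.lt_iff, Fin.lt_def, Fin.lt_def, Fin.ext_iff]

lemma exists_smoothGrid_of_refined (T : Tournament n) {K R : ℕ} (hR : 0 < R) {lam : ℝ}
    (hlam : 0 < lam) (A : Fin (2 * K) → Finset (Fin n))
    (hdisj : ∀ x y, x ≠ y → Disjoint (A x) (A y))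
    (hsize : ∀ x, R ≤ (A x).card)
    (htrans : ∀ x, x.val % 2 = 1 → T.IsTransOn (A x))
    (harcs : ∀ x y, (T.nonFwd x y (A x) (A y) : ℝ) ≤
      lam / (16 * (K * R) * R ^ 2) * (A x).card * (A y).card) :
    ∃ (S : Fin K ×ₗ Fin R → Finset (Fin n)) (idx : Fin K ×ₗ Fin R → Fin (2 * K)),
      (∀ x, S x ⊆ A (idx x) ∧ (A (idx x)).card ≤ 4 * R * (S x).card) ∧
      (∀ x, (ofLex x).2.val = 0 → (idx x).val % 2 = 0) ∧
      (∀ x, (ofLex x).2.val ≠ 0 → (idx x).val % 2 = 1) ∧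
      (∀ x y, x ≠ y → Disjoint (S x) (S y)) ∧
      (∀ x y, ∀ v ∈ S x,
        (((S y).filter fun u => ¬ T.Fwd x y v u).card : ℝ) ≤ lam * (S y).card) ∧
      (∀ x y, (ofLex x).1 = (ofLex y).1 → (ofLex x).2.val ≠ 0 →
        (ofLex y).2.val ≠ 0 → ∀ v ∈ S x, ∀ u ∈ S y, T.Fwd x y v u) := by
  have hpiece : ∀ j : Fin (2 * K), ∃ P : Fin R → Finset (Fin n),
      (∀ i, P i ⊆ A j ∧ (A j).card ≤ 2 * R * (P i).card) ∧
      (j.val % 2 = 1 → ∀ i i', i < i' → ∀ u ∈ P i, ∀ v ∈ P i', T.adj u v) := by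
    intro j
    by_cases hj : j.val % 2 = 1
    · obtain ⟨P, hP, hlt⟩ := exists_pieces (A j) T.adj (fun u _ => T.adj_irrefl u) (htrans j hj)
        (fun u _ v _ => T.total u v) hR (hsize j)
      exact ⟨P, hP, fun _ => hlt⟩
    · exact ⟨fun _ => A j, fun _ => ⟨subset_rfl, by nlinarith [Nat.zero_le (A j).card]⟩,
        fun h => absurd h hj⟩
  choose P hP hPlt using hpiece
  let idx : Fin K ×ₗ Fin R → Fin (2 * K) := fun x =>
    if (ofLex x).2.val = 0 then ⟨2 * (ofLex x).1.val, by omega⟩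
    else ⟨2 * (ofLex x).1.val + 1, by omega⟩
  have hidx0 : ∀ x, (ofLex x).2.val = 0 → (idx x).val = 2 * (ofLex x).1.val := by
    intro x hx
    simp [idx, hx]
  have hidx1 : ∀ x, (ofLex x).2.val ≠ 0 → (idx x).val = 2 * (ofLex x).1.val + 1 := by
    intro x hx
    simp [idx, hx]
  let S₀ : Fin K ×ₗ Fin R → Finset (Fin n) := fun x => P (idx x) (ofLex x).2
  have hcase : ∀ x y, x < y → idx x < idx y ∨
      (idx x = idx y ∧ (idx x).val % 2 = 1 ∧ (ofLex x).2 < (ofLex y).2) := by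
    intro x y hxy
    rw [grid_lt_iff] at hxy
    rw [Fin.lt_def, Fin.lt_def, Fin.ext_iff]
    by_cases h1 : (ofLex x).2.val = 0 <;> by_cases h2 : (ofLex y).2.val = 0
    · rw [hidx0 x h1, hidx0 y h2]; omega
    · rw [hidx0 x h1, hidx1 y h2]; omega
    · rw [hidx1 x h1, hidx0 y h2]; omega
    · rw [hidx1 x h1, hidx1 y h2]; omega
  have hS₀fwd : ∀ x y, x < y → idx x = idx y → ∀ v ∈ S₀ x, ∀ u ∈ S₀ y, T.adj v u := by
    intro x y hxy hid v hv u hu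
    rcases hcase x y hxy with h | ⟨h, hodd, h2⟩
    · exact absurd hid h.ne
    · have hu' : u ∈ P (idx x) (ofLex y).2 := by rw [h]; exact hu
      exact hPlt (idx x) hodd _ _ h2 v hv u hu'
  have hS₀fwd' : ∀ x y, idx x = idx y → ∀ v ∈ S₀ x, ∀ u ∈ S₀ y, T.Fwd x y v u :=
    fun x y hid v hv u hu => ⟨fun h => hS₀fwd x y h hid v hv u hu,
      fun h => hS₀fwd y x h hid.symm u hu v hv⟩
  have hS₀disj : ∀ x y, x ≠ y → Disjoint (S₀ x) (S₀ y) := by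
    intro x y hxy
    by_cases hid : idx x = idx y
    · rw [disjoint_left]
      intro u hu hu'
      rcases lt_or_gt_of_ne hxy with h | h
      · exact T.adj_irrefl u (hS₀fwd x y h hid u hu u hu')
      · exact T.adj_irrefl u (hS₀fwd y x h hid.symm u hu' u hu)
    · exact disjoint_of_subset_left (hP _ _).1 (disjoint_of_subset_right (hP _ _).1
        (hdisj _ _ hid))
  have hfwdidx : ∀ x y, idx x ≠ idx y → ∀ v u, T.Fwd (idx x) (idx y) v u → T.Fwd x y v u := by
    intro x y hid v u h
    constructor
    · intro hxy
      rcases hcase x y hxy with h' | h'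
      · exact h.1 h'
      · exact absurd h'.1 hid
    · intro hxy
      rcases hcase y x hxy with h' | h'
      · exact h.2 h'
      · exact absurd h'.1.symm hid
  have hL : Fintype.card (Fin K ×ₗ Fin R) = K * R := by simp [Fintype.card_lex]
  by_cases hK : K = 0
  · subst hK
    exact ⟨S₀, idx, fun x => (ofLex x).1.elim0, fun x => (ofLex x).1.elim0,
      fun x => (ofLex x).1.elim0, fun x => (ofLex x).1.elim0, fun x => (ofLex x).1.elim0,
      fun x => (ofLex x).1.elim0⟩
  have hK0 : (0 : ℝ) < K := by exact_mod_cast Nat.pos_of_ne_zero hK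
  have hR0 : (0 : ℝ) < R := by exact_mod_cast hR
  set mu : ℝ := lam / (16 * (K * R) * R ^ 2) with hmu
  have hmu0 : 0 < mu := by positivity
  have hS₀ : ∀ x y, (T.nonFwd x y (S₀ x) (S₀ y) : ℝ) ≤
      (4 * R ^ 2 * mu) * (S₀ x).card * (S₀ y).card := by
    intro x y
    by_cases hid : idx x = idx y
    · rw [T.nonFwd_eq_zero (hS₀fwd' x y hid)]
      simp only [Nat.cast_zero]
      positivity
    · have h1 : T.nonFwd x y (S₀ x) (S₀ y) ≤
          T.nonFwd (idx x) (idx y) (A (idx x)) (A (idx y)) := by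
        refine le_trans ?_ 
          (T.nonFwd_mono (idx x) (idx y) (hP (idx x) (ofLex x).2).1 (hP (idx y) (ofLex y).2).1)
        refine sum_le_sum fun v _ => card_le_card fun u hu => ?_
        rw [mem_filter] at hu ⊢
        exact ⟨hu.1, fun h => hu.2 (hfwdidx x y hid v u h)⟩
      have h2 : ∀ x, ((A (idx x)).card : ℝ) ≤ 2 * R * (S₀ x).card := fun x => by
        exact_mod_cast (hP (idx x) (ofLex x).2).2
      calc (T.nonFwd x y (S₀ x) (S₀ y) : ℝ)
          ≤ T.nonFwd (idx x) (idx y) (A (idx x)) (A (idx y)) := by exact_mod_cast h1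
        _ ≤ mu * (A (idx x)).card * (A (idx y)).card := harcs _ _
        _ ≤ mu * (2 * R * (S₀ x).card) * (2 * R * (S₀ y).card) :=
            mul_le_mul (mul_le_mul_of_nonneg_left (h2 x) hmu0.le) (h2 y) (Nat.cast_nonneg _)
              (mul_nonneg hmu0.le (mul_nonneg (mul_nonneg zero_le_two hR0.le) (Nat.cast_nonneg _)))
        _ = _ := by ring
  choose S hSsub hSc hS using T.exists_clean S₀ (by positivity) hS₀
  refine ⟨S, idx, fun x => ⟨(hSsub x).trans (hP _ _).1, ?_⟩, fun x hx => ?_, fun x hx => ?_,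
    fun x y hxy => disjoint_of_subset_left (hSsub x) (disjoint_of_subset_right (hSsub y)
      (hS₀disj x y hxy)), fun x y v hv => ?_, fun x y hl hx hy v hv u hu => ?_⟩
  · have h1 := (hP (idx x) (ofLex x).2).2
    have h2 := hSc x
    calc (A (idx x)).card ≤ 2 * R * (S₀ x).card := h1
      _ ≤ 2 * R * (2 * (S x).card) := Nat.mul_le_mul_left _ h2
      _ = 4 * R * (S x).card := by ring
  · rw [hidx0 x hx]; omega
  · rw [hidx1 x hx]; omega
  · have h1 : (((S y).filter fun u => ¬ T.Fwd x y v u).card : ℝ) ≤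
        ((S₀ y).filter fun u => ¬ T.Fwd x y v u).card := by
      exact_mod_cast card_le_card (filter_subset_filter _ (hSsub y))
    refine h1.trans ((hS x v hv y).trans ?_)
    have h2 : ((S₀ y).card : ℝ) ≤ 2 * (S y).card := by exact_mod_cast hSc y
    rw [hL]
    calc 2 * ((K * R : ℕ) : ℝ) * (4 * R ^ 2 * mu) * (S₀ y).card
        ≤ 2 * ((K * R : ℕ) : ℝ) * (4 * R ^ 2 * mu) * (2 * (S y).card) := by gcongr
      _ = lam * (S y).card := by
          have h3 : mu * (16 * (K * R) * R ^ 2) = lam := div_mul_cancel₀ _ (by positivity)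
          rw [← h3]
          push_cast
          ring
  · refine hS₀fwd' x y ?_ v (hSsub x hv) u (hSsub y hu)
    rw [Fin.ext_iff, hidx1 x hx, hidx1 y hy, hl]

theorem exists_smoothGrid {h : ℕ} (H : Tournament h) {K R : ℕ} (hK : 0 < K) (hR : 0 < R)
    {lam δ : ℝ} (hlam : 0 < lam) (hlam1 : lam ≤ 1) (hδ : 0 < δ) (hδ1 : δ ≤ 1) :
    ∃ ε : ℝ, 0 < ε ∧ ∀ (n : ℕ) (T : Tournament n), ¬ T.Contains H → ∀ W : Finset (Fin n),
      (T.trSizeOn W : ℝ) < (W.card : ℝ) ^ ε →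
      (∀ s, s ⊂ W → (s.card : ℝ) ^ ε ≤ T.trSizeOn s) →
      ∃ S : Fin K ×ₗ Fin R → Finset (Fin n), T.IsSmoothGrid lam δ S := by
  have hK1 : (1 : ℝ) ≤ K := by exact_mod_cast hK
  have hR1 : (1 : ℝ) ≤ R := by exact_mod_cast hR
  set mu : ℝ := lam / (16 * (K * R) * R ^ 2) with hmu
  have hmu0 : 0 < mu := by positivity
  have hmu1 : mu ≤ 1 := by
    have : (1 : ℝ) ≤ 16 * (K * R) * R ^ 2 := by
      have h1 : (1 : ℝ) ≤ K * R := one_le_mul_of_one_le_of_one_le hK1 hR1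
      have h2 : (1 : ℝ) ≤ R ^ 2 := one_le_pow₀ hR1
      nlinarith
    rw [hmu, div_le_one (by positivity)]
    linarith
  set Q : ℝ := 2 * Fintype.card (Fin (2 * K)) with hQ
  have hQ1 : 1 ≤ Q := by
    rw [hQ, Fintype.card_fin]
    push_cast
    linarith
  obtain ⟨c, hc, hc1, hchain⟩ := exists_sparse_chain H (2 * K) (mu / Q ^ (2 * K))
    (by positivity) (div_le_one_of_le₀ (hmu1.trans (one_le_pow₀ hQ1)) (by positivity))
  set η : ℝ := δ / (8 * R) with hη
  have hη0 : 0 < η := by positivity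
  have hη2 : η ≤ 1 / 2 := by
    rw [hη, div_le_div_iff₀ (by positivity) (by norm_num)]
    linarith
  set β : ℝ := δ * c / (4 * R) with hβ
  have hβ0 : 0 < β := by positivity
  have hβc : β ≤ c / 2 := by
    rw [hβ, div_le_div_iff₀ (by positivity) (by norm_num)]
    nlinarith [mul_le_mul hδ1 hR1 zero_le_one zero_le_one]
  set C : ℝ := max (2 ^ (2 * R)) (R / c) with hC
  have hC0 : 0 < C := lt_max_of_lt_left (by positivity)
  obtain ⟨ε, hε, hεβ, hεC⟩ := exists_small_exponent hβ0 hη0 hC0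
  refine ⟨ε, hε, fun n T hT W hW hmin => ?_⟩
  obtain ⟨ht1, hWC⟩ := T.critical_large hε hεC hW
  set t : ℝ := (T.trSizeOn W : ℝ) with ht
  have ht0 : (1 : ℝ) ≤ t := by rw [ht]; exact_mod_cast ht1
  have hcWR : (R : ℝ) ≤ c * W.card := by
    have : R / c ≤ W.card := (le_max_right _ _).trans hWC.le
    rwa [div_le_iff₀' hc] at this
  have hcW : 1 ≤ c * W.card := hR1.trans hcWR
  have htR : 2 * (R : ℝ) ≤ t := by
    have : (2 : ℝ) ^ (2 * R) ≤ W.card := (le_max_left _ _).trans hWC.le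
    obtain ⟨X, hXW, hX, hXc⟩ := T.exists_isTransOn_card (2 * R) W (by exact_mod_cast this)
    have h2 := T.card_le_trSizeOn hXW hX
    have h3 : 2 * R ≤ T.trSizeOn W := by omega
    rw [ht]
    exact_mod_cast h3
  have hlin : ∀ B, B ⊂ W → β * W.card ≤ B.card → (1 - η) * t < T.trSizeOn B := by
    intro B hB hBc
    calc (1 - η) * t < β ^ ε * (W.card : ℝ) ^ ε := by
          refine mul_lt_mul' hεβ.le hW (by positivity) (by positivity)
      _ = (β * W.card) ^ ε := (Real.mul_rpow hβ0.le (Nat.cast_nonneg _)).symm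
      _ ≤ (B.card : ℝ) ^ ε := Real.rpow_le_rpow (by positivity) hBc hε.le
      _ ≤ T.trSizeOn B := hmin B hB
  obtain ⟨A', hA'W, hA'⟩ := hchain n T hT W hcW
  let A : Fin (2 * K) → Finset (Fin n) := fun x => A' x.val
  have hAdisj : ∀ x y, x ≠ y → Disjoint (A x) (A y) := by
    intro x y hxy
    rcases lt_or_gt_of_ne hxy with h | h
    · exact (hA' y.val y.2 x.val h).1
    · exact (hA' x.val x.2 y.val h).1.symm
  have hAc : ∀ x, c * W.card ≤ (A x).card := fun x => (hA'W x.val x.2).2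
  have hAW : ∀ x, A x ⊂ W := by
    intro x
    refine ⟨(hA'W x.val x.2).1, fun hsub => ?_⟩
    obtain ⟨y, hy⟩ : ∃ y : Fin (2 * K), y ≠ x := by
      by_cases hx : x.val = 0
      · exact ⟨⟨1, by omega⟩, fun h => by simp [← h] at hx⟩
      · exact ⟨⟨0, by omega⟩, fun h => hx (by simp [← h])⟩
    have h1 : (0 : ℝ) < (A y).card := by linarith [hAc y]
    obtain ⟨u, hu⟩ := card_pos.1 (Nat.cast_pos.1 h1)
    exact disjoint_left.1 (hAdisj y x hy) hu (hsub ((hA'W y.val y.2).1 hu))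
  have hAarcs : ∀ x y, (T.nonFwd x y (A x) (A y) : ℝ) ≤
      mu / Q ^ (2 * K) * (A x).card * (A y).card := by
    have key : ∀ x y, x < y → (T.nonFwd x y (A x) (A y) : ℝ) ≤
        mu / Q ^ (2 * K) * (A x).card * (A y).card := fun x y hxy => by
      rw [T.nonFwd_of_lt hxy]
      exact (hA' y.val y.2 x.val hxy).2
    intro x y
    rcases lt_trichotomy x y with hxy | rfl | hxy
    · exact key x y hxy
    · rw [T.nonFwd_eq_zero fun v _ u _ => T.fwd_self x v u]
      simp only [Nat.cast_zero]
      positivity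
    · rw [nonFwd_comm, mul_right_comm]
      exact key y x hxy
  obtain ⟨A₁, hA₁sub, hA₁odd, hA₁even, hA₁⟩ := T.exists_transitive_refinement A (g := t / 2)
    (by positivity) hAarcs (univ.filter fun x => x.val % 2 = 1) (by
      intro x _ B hB hBc
      obtain ⟨X, hXB, hX, hXc⟩ := T.exists_card_eq_trSizeOn B
      refine ⟨X, hXB, hX, ?_⟩
      have h1 : ((A x).card : ℝ) ≤ 2 * B.card := by exact_mod_cast hBc
      have h2 := hlin B (hB.trans_ssubset (hAW x)) (by nlinarith [hAc x])
      rw [hXc]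
      nlinarith)
  simp only [mem_filter, mem_univ, true_and] at hA₁odd hA₁even
  have hA₁R : ∀ x, R ≤ (A₁ x).card := by
    intro x
    by_cases hx : x.val % 2 = 1
    · have h1 : (R : ℝ) ≤ (A₁ x).card := by linarith [(hA₁odd x hx).2]
      exact_mod_cast h1
    · rw [hA₁even x hx]
      exact_mod_cast hcWR.trans (hAc x)
  obtain ⟨S, idx, hSA, hidx0, hidx1, hSdisj, hSsm, hSl⟩ := T.exists_smoothGrid_of_refined hR hlam
    A₁ (fun x y hxy => disjoint_of_subset_left (hA₁sub x) (disjoint_of_subset_right (hA₁sub y)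
      (hAdisj x y hxy))) hA₁R (fun x hx => (hA₁odd x hx).1) (by
      intro x y
      refine (hA₁ x y).trans ?_
      gcongr
      rw [← hmu, ← hQ, mul_div_assoc', div_le_iff₀ (by positivity), mul_comm]
      gcongr
      · exact (card_le_univ _).trans_eq (Fintype.card_fin _))
  have hSW : ∀ x, S x ⊆ A (idx x) := fun x => (hSA x).1.trans (hA₁sub _)
  have hScard : ∀ x, ((A₁ (idx x)).card : ℝ) ≤ 4 * R * (S x).card := fun x => by
    exact_mod_cast (hSA x).2
  have hlinX : ∀ x, (ofLex x).2.val = 0 → ∀ X ⊆ S x, δ * (S x).card ≤ X.card →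
      (1 - η) * t < T.trSizeOn X := by
    intro x hx X hX hXc
    refine hlin X ((hX.trans (hSW x)).trans_ssubset (hAW _)) ?_
    have h1 := hScard x
    rw [hA₁even _ (by rw [hidx0 x hx]; norm_num)] at h1
    have h2 := (hAc (idx x)).trans h1
    rw [hβ, div_mul_eq_mul_div, div_le_iff₀ (by positivity)]
    calc δ * c * W.card = δ * (c * W.card) := by ring
      _ ≤ δ * (4 * R * (S x).card) := by gcongr
      _ = δ * (S x).card * (4 * R) := by ring
      _ ≤ X.card * (4 * R) := by gcongr
  have hany : ∀ y, ∀ Y ⊆ S y, δ * (S y).card ≤ Y.card → η * t ≤ T.trSizeOn Y := by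
    intro y Y hY hYc
    by_cases hy : (ofLex y).2.val = 0
    · have := hlinX y hy Y hY hYc
      nlinarith
    · have hodd := hA₁odd _ (hidx1 y hy)
      have h1 : Y.card ≤ T.trSizeOn Y :=
        T.card_le_trSizeOn subset_rfl (hodd.1.mono (hY.trans (hSA y).1))
      have h2 : (Y.card : ℝ) ≤ T.trSizeOn Y := by exact_mod_cast h1
      refine le_trans ?_ h2
      rw [hη, div_mul_eq_mul_div, div_le_iff₀ (by positivity)]
      have h3 := hodd.2.trans (hScard y)
      calc δ * t ≤ δ * (2 * (4 * R * (S y).card)) := by gcongr; linarith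
        _ = δ * (S y).card * (8 * R) := by ring
        _ ≤ Y.card * (8 * R) := by gcongr
  refine ⟨S, ?_, hSdisj, hSsm, hSl, ?_⟩
  · intro x
    rw [nonempty_iff_ne_empty]
    intro hx
    have h1 := (hSA x).2
    have h2 := hA₁R (idx x)
    rw [hx, card_empty] at h1
    omega
  · intro x y hxy hx X hX Y hY hXc hYc
    by_contra hcon
    push Not at hcon
    have hXW := (hX.trans (hSW x)).trans (hAW _).1
    have hYW := (hY.trans (hSW y)).trans (hAW _).1
    have hne : ∀ v ∈ X, ∀ u ∈ Y, v ≠ u := fun v hv u hu hvu =>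
      disjoint_left.1 (hSdisj x y hxy) (hX hv) (hY (hvu ▸ hu))
    have hsum : T.trSizeOn X + T.trSizeOn Y ≤ T.trSizeOn W := by
      rcases lt_or_gt_of_ne hxy with h | h
      · refine T.trSizeOn_add_le hXW hYW fun v hv u hu =>
          T.adj_of_not_adj (hne v hv u hu) fun hadj => hcon v hv u hu ?_
        exact ⟨fun h' => absurd h' h.not_gt, fun _ => hadj⟩
      · rw [add_comm]
        refine T.trSizeOn_add_le hYW hXW fun u hu v hv =>
          T.adj_of_not_adj (hne v hv u hu).symm fun hadj => hcon v hv u hu ?_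
        exact ⟨fun _ => hadj, fun h' => absurd h' h.not_gt⟩
    have hsum' : (T.trSizeOn X : ℝ) + T.trSizeOn Y ≤ t := by
      rw [ht]
      exact_mod_cast hsum
    linarith [hlinX x hx X hX hXc, hany y Y hY hYc]

lemma pos_lt_of_adj {h : ℕ} {H : Tournament h} {θ : Equiv.Perm (Fin h)} {x y : Fin h}
    (hb : ¬ H.Backward θ x y) (hadj : H.adj x y) : pos θ x < pos θ y := by
  rcases lt_trichotomy (pos θ x) (pos θ y) with hlt | heq | hlt
  · exact hlt
  · rw [θ.symm.injective heq] at hadj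
    exact absurd hadj (H.adj_irrefl y)
  · exact absurd ⟨hadj, hlt⟩ hb

lemma exists_grouping {h : ℕ} {κ : Type*} (A : κ → Finset (Fin h))
    (hA : ∀ i j, i ≠ j → Disjoint (A i) (A j)) :
    ∃ grp : Fin h → κ ⊕ Fin h, (∀ x i, grp x = Sum.inl i ↔ x ∈ A i) ∧
      ∀ x y, grp x = Sum.inr y → x = y := by
  refine ⟨fun x => if hx : ∃ i, x ∈ A i then Sum.inl hx.choose else Sum.inr x,
    fun x i => ?_, fun x y => ?_⟩
  · by_cases hx : ∃ i, x ∈ A i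
    · simp only [dif_pos hx, Sum.inl.injEq]
      refine ⟨fun hi => hi ▸ hx.choose_spec, fun hi => ?_⟩
      by_contra hne
      exact disjoint_left.1 (hA _ _ hne) hx.choose_spec hi
    · simp only [dif_neg hx, reduceCtorEq, false_iff]
      exact fun hi => hx ⟨i, hi⟩
  · by_cases hx : ∃ i, x ∈ A i
    · simp [dif_pos hx]
    · simp [dif_neg hx]

/-- If the arcs of `H` joining different groups are forward for the placement `φ` in a smooth
family of sets, and each group can be embedded in large subsets, then `H` can be embedded. -/
theorem exists_embedding_of_groups {h : ℕ} {γ : Type*} (T : Tournament n) (H : Tournament h)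
    {S : ι → Finset (Fin n)} {lam : ℝ} (hlam : 0 ≤ lam)
    (hsm : ∀ x y, ∀ v ∈ S x,
      (((S y).filter fun u => ¬ T.Fwd x y v u).card : ℝ) ≤ lam * (S y).card)
    (U : Finset (Fin h)) (grp : Fin h → γ) (φ : Fin h → ι) (S' : Fin h → Finset (Fin n))
    (hfwd : ∀ x ∈ U, ∀ y ∈ U, grp x ≠ grp y → H.adj x y → φ x < φ y)
    (hS' : ∀ x, S' x ⊆ S (φ x))
    (hcard : ∀ x, (1 / 2 + h * lam) * (S (φ x)).card ≤ (S' x).card)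
    (hgrp : ∀ g, ∀ S'' : Fin h → Finset (Fin n), (∀ x, S'' x ⊆ S' x) →
      (∀ x, ((S (φ x)).card : ℝ) / 2 ≤ (S'' x).card) →
      ∃ f : Fin h → Fin n, (∀ x ∈ U, grp x = g → f x ∈ S'' x) ∧
        ∀ x ∈ U, ∀ y ∈ U, grp x = g → grp y = g → H.adj x y → T.adj (f x) (f y)) :
    ∃ f : Fin h → Fin n, (∀ x ∈ U, f x ∈ S' x) ∧
      ∀ x ∈ U, ∀ y ∈ U, H.adj x y → T.adj (f x) (f y) := by
  have key : ∀ D : Finset γ, ∃ f : Fin h → Fin n, (∀ x ∈ U, grp x ∈ D → f x ∈ S' x) ∧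
      ∀ x ∈ U, ∀ y ∈ U, grp x ∈ D → grp y ∈ D → H.adj x y → T.adj (f x) (f y) := by
    intro D
    induction D using Finset.induction_on with
    | empty =>
      obtain ⟨f⟩ : Nonempty (Fin h → Fin n) := by
        rcases isEmpty_or_nonempty (Fin h) with hh | ⟨⟨x⟩⟩
        · exact ⟨isEmptyElim⟩
        · obtain ⟨f, -⟩ := hgrp (grp x) S' (fun _ => subset_rfl) fun y => by
            refine le_trans ?_ (hcard y)
            nlinarith [mul_nonneg (mul_nonneg (Nat.cast_nonneg (α := ℝ) h) hlam)
              (Nat.cast_nonneg (α := ℝ) (S (φ y)).card)]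
          exact ⟨f⟩
      exact ⟨f, by simp, by simp⟩
    | insert g D hg ih =>
      obtain ⟨f₀, hf₀, hf₀adj⟩ := ih
      set Y := U.filter fun y => grp y ∈ D with hY
      have hYU : ∀ y ∈ Y, y ∈ U ∧ grp y ∈ D := fun y hy => mem_filter.1 hy
      have hsub : ∀ x, ∃ B ⊆ S' x, (∀ u ∈ B, ∀ y ∈ Y, T.Fwd (φ y) (φ x) (f₀ y) u) ∧
          ((S' x).card : ℝ) - Y.card * (lam * (S (φ x)).card) ≤ B.card := fun x =>
        exists_subset_forall (S' x) Y (fun y u => T.Fwd (φ y) (φ x) (f₀ y) u) _ fun y hy =>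
          le_trans (by exact_mod_cast card_le_card (filter_subset_filter _ (hS' x)))
            (hsm (φ y) (φ x) (f₀ y) (hS' y (hf₀ y (hYU y hy).1 (hYU y hy).2)))
      choose S'' hS'' hS''fwd hS''card using hsub
      obtain ⟨f₁, hf₁, hf₁adj⟩ := hgrp g S'' hS'' fun x => by
        have h1 : (Y.card : ℝ) ≤ h := by
          exact_mod_cast (card_le_univ Y).trans_eq (Fintype.card_fin h)
        have h2 : (0 : ℝ) ≤ lam * (S (φ x)).card := by positivity
        nlinarith [hS''card x, hcard x, mul_le_mul_of_nonneg_right h1 h2]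
      have hin : ∀ x, grp x ∈ insert g D → grp x ≠ g → grp x ∈ D := fun x hx hne =>
        (mem_insert.1 hx).resolve_left hne
      refine ⟨fun x => if grp x = g then f₁ x else f₀ x, fun x hx hxD => ?_,
        fun x hx y hy hxD hyD hadj => ?_⟩
      · by_cases hxg : grp x = g
        · simpa only [if_pos hxg] using hS'' x (hf₁ x hx hxg)
        · simpa only [if_neg hxg] using hf₀ x hx (hin x hxD hxg)
      · by_cases hxg : grp x = g <;> by_cases hyg : grp y = g
        · simpa only [if_pos hxg, if_pos hyg] using hf₁adj x hx y hy hxg hyg hadj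
        · have hyY : y ∈ Y := mem_filter.2 ⟨hy, hin y hyD hyg⟩
          simpa only [if_pos hxg, if_neg hyg] using
            (hS''fwd x _ (hf₁ x hx hxg) y hyY).2
              (hfwd x hx y hy (fun h => hyg (h ▸ hxg)) hadj)
        · have hxY : x ∈ Y := mem_filter.2 ⟨hx, hin x hxD hxg⟩
          simpa only [if_neg hxg, if_pos hyg] using
            (hS''fwd y _ (hf₁ y hy hyg) x hxY).1
              (hfwd x hx y hy (fun h => hxg (h ▸ hyg)) hadj)
        · simpa only [if_neg hxg, if_neg hyg] using
            hf₀adj x hx y hy (hin x hxD hxg) (hin y hyD hyg) hadj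
  obtain ⟨f, hf, hfadj⟩ := key (U.image grp)
  have himg : ∀ x ∈ U, grp x ∈ U.image grp := fun x hx => mem_image_of_mem _ hx
  exact ⟨f, fun x hx => hf x hx (himg x hx),
    fun x hx y hy => hfadj x hx y hy (himg x hx) (himg y hy)⟩

namespace IsSmoothGrid

variable {T : Tournament n} {K R : ℕ} {lam δ : ℝ} {S : Fin K ×ₗ Fin R → Finset (Fin n)}

lemma card_pos (hS : T.IsSmoothGrid lam δ S) (x) : (0 : ℝ) < (S x).card :=
  Nat.cast_pos.2 (Finset.card_pos.2 (hS.nonempty x))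

/-- All but few vertices of a set indexed by the first position of a level are joined by a
backward arc to each of the given large sets. -/
lemma exists_good_centers {κ : Type*} (hS : T.IsSmoothGrid lam δ S) {x : Fin K ×ₗ Fin R}
    (hx : (ofLex x).2.val = 0) {A : Finset (Fin n)} (hA : A ⊆ S x) (Y : Finset κ)
    (p : κ → Fin K ×ₗ Fin R) (B : κ → Finset (Fin n)) (hp : ∀ y ∈ Y, p y ≠ x)
    (hB : ∀ y ∈ Y, B y ⊆ S (p y)) (hBc : ∀ y ∈ Y, δ * (S (p y)).card ≤ (B y).card) :
    ∃ C ⊆ A, (∀ v ∈ C, ∀ y ∈ Y, ∃ u ∈ B y, T.Fwd (p y) x v u) ∧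
      (A.card : ℝ) - Y.card * (δ * (S x).card) ≤ C.card := by
  obtain ⟨P, hP⟩ : ∃ P : κ → Fin n → Prop, ∀ y v, P y v ↔ ∃ u ∈ B y, T.Fwd (p y) x v u :=
    ⟨_, fun _ _ => Iff.rfl⟩
  simp only [← hP]
  refine exists_subset_forall A Y P _ fun y hy => ?_
  by_contra hlt
  rw [not_le] at hlt
  obtain ⟨v, hv, u, hu, hvu⟩ := hS.crit x (p y) (hp y hy).symm hx _
    ((filter_subset _ A).trans hA) (B y) (hB y hy) hlt.le (hBc y hy)
  exact (mem_filter.1 hv).2 ((hP y v).2 ⟨u, hu, hvu⟩)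

lemma exists_star_embedding {h : ℕ} (hS : T.IsSmoothGrid lam δ S) (hδ0 : 0 < δ)
    (hδ : 2 * (h + 1) * δ ≤ 1) (H : Tournament h) (φ : Fin h → Fin K ×ₗ Fin R)
    (S' : Fin h → Finset (Fin n)) (hS' : ∀ x, S' x ⊆ S (φ x))
    (hcard : ∀ x, ((S (φ x)).card : ℝ) / 2 ≤ (S' x).card) (z : Fin h) (L : Finset (Fin h))
    (hz : (ofLex (φ z)).2.val = 0)
    (hL : ∀ y ∈ L, φ z < φ y ∧ H.adj y z ∨ φ y < φ z ∧ H.adj z y)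
    (hleaf : ∀ y ∈ L, ∀ y' ∈ L, H.adj y y' → ∀ v ∈ S' z, ∀ u ∈ S' y, ∀ u' ∈ S' y',
      T.Fwd (φ y) (φ z) v u → T.Fwd (φ y') (φ z) v u' → T.adj u u') :
    ∃ f : Fin h → Fin n, (∀ x ∈ insert z L, f x ∈ S' x) ∧
      ∀ x ∈ insert z L, ∀ y ∈ insert z L, H.adj x y → T.adj (f x) (f y) := by
  have hne : ∀ y ∈ L, φ y ≠ φ z := fun y hy => by
    rcases hL y hy with h | h
    · exact h.1.ne'
    · exact h.1.ne
  have hLc : (L.card : ℝ) ≤ h := by exact_mod_cast (card_le_univ L).trans_eq (Fintype.card_fin h)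
  have hδ2 : δ ≤ 1 / 2 := by nlinarith [Nat.cast_nonneg (α := ℝ) h]
  obtain ⟨C, hCA, hC, hCc⟩ := hS.exists_good_centers hz (hS' z) L φ S' hne
    (fun y _ => hS' y) fun y _ => le_trans (by nlinarith [hS.card_pos (φ y)]) (hcard y)
  have hCpos : (0 : ℝ) < C.card := by
    have h1 := hS.card_pos (φ z)
    have h2 := mul_le_mul_of_nonneg_right hLc (mul_nonneg hδ0.le h1.le)
    nlinarith [hcard z, mul_pos hδ0 h1]
  obtain ⟨v, hv⟩ := Finset.card_pos.1 (Nat.cast_pos.1 hCpos)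
  have : Nonempty (Fin n) := ⟨v⟩
  choose! f hf hfv using hC v hv
  have hzL : z ∉ L := fun hzL => hne z hzL rfl
  have hmem : ∀ x ∈ L, x ≠ z := fun x hx h => hzL (h ▸ hx)
  refine ⟨Function.update f z v, fun x hx => ?_, fun x hx y hy hadj => ?_⟩
  · rcases mem_insert.1 hx with rfl | hx
    · simpa using hCA hv
    · simpa [hmem x hx] using hf x hx
  · rcases mem_insert.1 hx with rfl | hxL <;> rcases mem_insert.1 hy with rfl | hyL
    · exact absurd hadj (H.adj_irrefl _)
    · rw [Function.update_self, Function.update_of_ne (hmem y hyL)]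
      rcases hL y hyL with h | h
      · exact absurd h.2 (H.asymm _ _ hadj)
      · exact (hfv y hyL).1 h.1
    · rw [Function.update_self, Function.update_of_ne (hmem x hxL)]
      rcases hL x hxL with h | h
      · exact (hfv x hxL).2 h.1
      · exact absurd h.2 (H.asymm _ _ hadj)
    · rw [Function.update_of_ne (hmem x hxL), Function.update_of_ne (hmem y hyL)]
      exact hleaf x hxL y hyL hadj v (hCA hv) _ (hf x hxL) _ (hf y hyL) (hfv x hxL) (hfv y hyL)

lemma exists_super_right_embedding {h : ℕ} (hS : T.IsSmoothGrid lam δ S) (hδ0 : 0 < δ)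
    (hδ : 2 * (h + 1) * δ ≤ 1) (H : Tournament h) (φ : Fin h → Fin K ×ₗ Fin R)
    (S' : Fin h → Finset (Fin n)) (hS' : ∀ x, S' x ⊆ S (φ x))
    (hcard : ∀ x, ((S (φ x)).card : ℝ) / 2 ≤ (S' x).card) (z₁ z₂ : Fin h)
    (L₁ L₂ : Finset (Fin h)) (hz₁ : (ofLex (φ z₁)).2.val = 0) (hz₂ : (ofLex (φ z₂)).2.val = 0)
    (hz : φ z₁ < φ z₂) (hzadj : H.adj z₂ z₁) (hdisj : Disjoint L₁ L₂)
    (hL : ∀ y ∈ L₁ ∪ L₂, φ z₂ < φ y)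
    (hL₁ : ∀ y ∈ L₁, H.adj y z₁) (hL₂ : ∀ y ∈ L₂, H.adj y z₂)
    (hL₁' : ∀ y ∈ L₁, H.adj z₂ y) (hL₂' : ∀ y ∈ L₂, H.adj z₁ y)
    (hleaf : ∀ y ∈ L₁ ∪ L₂, ∀ y' ∈ L₁ ∪ L₂, H.adj y y' → ∀ u ∈ S' y, ∀ u' ∈ S' y', T.adj u u')
    (htri : ∀ y ∈ L₁ ∪ L₂, ∀ v₁ ∈ S' z₁, ∀ v₂ ∈ S' z₂, ∀ u ∈ S' y,
      ¬ (T.adj v₂ v₁ ∧ T.adj u v₁ ∧ T.adj u v₂)) :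
    ∃ f : Fin h → Fin n, (∀ x ∈ insert z₁ (insert z₂ (L₁ ∪ L₂)), f x ∈ S' x) ∧
      ∀ x ∈ insert z₁ (insert z₂ (L₁ ∪ L₂)), ∀ y ∈ insert z₁ (insert z₂ (L₁ ∪ L₂)),
        H.adj x y → T.adj (f x) (f y) := by
  have hδ2 : δ ≤ 1 / 2 := by nlinarith [Nat.cast_nonneg (α := ℝ) h]
  have hhalf : ∀ y, δ * (S (φ y)).card ≤ (S' y).card := fun y =>
    le_trans (by nlinarith [hS.card_pos (φ y)]) (hcard y)
  have hgood : ∀ z : Fin h, ∀ L : Finset (Fin h), (ofLex (φ z)).2.val = 0 →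
      (∀ y ∈ L, φ y ≠ φ z) → ∃ C ⊆ S' z, (∀ v ∈ C, ∀ y ∈ L, ∃ u ∈ S' y, T.Fwd (φ y) (φ z) v u) ∧
        δ * (S (φ z)).card ≤ C.card := by
    intro z L hz hne
    obtain ⟨C, hCA, hC, hCc⟩ := hS.exists_good_centers hz (hS' z) L φ S' hne
      (fun y _ => hS' y) fun y _ => hhalf y
    refine ⟨C, hCA, hC, ?_⟩
    have hLc : (L.card : ℝ) ≤ h := by
      exact_mod_cast (card_le_univ L).trans_eq (Fintype.card_fin h)
    have h1 := hS.card_pos (φ z)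
    have h2 := mul_le_mul_of_nonneg_right hLc (mul_nonneg hδ0.le h1.le)
    nlinarith [hcard z, mul_pos hδ0 h1]
  have hLne₁ : ∀ y ∈ L₁, φ y ≠ φ z₁ := fun y hy => (hz.trans (hL y (mem_union_left _ hy))).ne'
  have hLne₂ : ∀ y ∈ L₂, φ y ≠ φ z₂ := fun y hy => (hL y (mem_union_right _ hy)).ne'
  obtain ⟨C₁, hC₁S, hC₁, hC₁c⟩ := hgood z₁ L₁ hz₁ hLne₁
  obtain ⟨C₂, hC₂S, hC₂, hC₂c⟩ := hgood z₂ L₂ hz₂ hLne₂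
  obtain ⟨v₁, hv₁, v₂, hv₂, hv⟩ := hS.crit (φ z₁) (φ z₂) hz.ne hz₁ C₁ (hC₁S.trans (hS' _)) C₂
    (hC₂S.trans (hS' _)) hC₁c hC₂c
  have hv21 : T.adj v₂ v₁ := hv.2 hz
  have : Nonempty (Fin n) := ⟨v₁⟩
  choose! f₁ hf₁ hf₁v using hC₁ v₁ hv₁
  choose! f₂ hf₂ hf₂v using hC₂ v₂ hv₂
  have hneS : ∀ x y, φ x ≠ φ y → ∀ u ∈ S' x, ∀ u' ∈ S' y, u ≠ u' := fun x y hxy u hu u' hu' h =>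
    disjoint_left.1 (hS.disjoint _ _ hxy) (hS' x hu) (hS' y (h ▸ hu'))
  have hz21 : z₂ ≠ z₁ := fun h => hz.ne (by rw [h])
  let f : Fin h → Fin n := fun x =>
    if x = z₁ then v₁ else if x = z₂ then v₂ else if x ∈ L₁ then f₁ x else f₂ x
  have hLz : ∀ y ∈ L₁ ∪ L₂, y ≠ z₁ ∧ y ≠ z₂ := fun y hy =>
    ⟨fun h => (hz.trans (hL y hy)).ne (by rw [h]), fun h => (hL y hy).ne (by rw [h])⟩
  have fz₁ : f z₁ = v₁ := by simp [f]
  have fz₂ : f z₂ = v₂ := by simp [f, hz21]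
  have fL₁ : ∀ y ∈ L₁, f y = f₁ y := fun y hy => by
    simp [f, hLz y (mem_union_left _ hy), hy]
  have fL₂ : ∀ y ∈ L₂, f y = f₂ y := fun y hy => by
    simp [f, hLz y (mem_union_right _ hy), disjoint_right.1 hdisj hy]
  have hfL : ∀ y ∈ L₁ ∪ L₂, f y ∈ S' y := fun y hy => by
    rcases mem_union.1 hy with hy | hy
    · rw [fL₁ y hy]; exact hf₁ y hy
    · rw [fL₂ y hy]; exact hf₂ y hy
  have hleafT : ∀ y ∈ L₁ ∪ L₂, ∀ y' ∈ L₁ ∪ L₂, H.adj y y' → T.adj (f y) (f y') :=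
    fun y hy y' hy' hadj => hleaf y hy y' hy' hadj _ (hfL y hy) _ (hfL y' hy')
  have harc₁ : ∀ y ∈ L₁, T.adj (f y) v₁ ∧ T.adj v₂ (f y) := fun y hy => by
    have hyL := mem_union_left L₂ hy
    have h1 : T.adj (f y) v₁ := by rw [fL₁ y hy]; exact (hf₁v y hy).2 (hz.trans (hL y hyL))
    refine ⟨h1, T.adj_of_not_adj (hneS z₂ y (hL y hyL).ne _ (hC₂S hv₂) _ (hfL y hyL)) fun h2 => ?_⟩
    exact htri y hyL v₁ (hC₁S hv₁) v₂ (hC₂S hv₂) _ (hfL y hyL) ⟨hv21, h1, h2⟩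
  have harc₂ : ∀ y ∈ L₂, T.adj (f y) v₂ ∧ T.adj v₁ (f y) := fun y hy => by
    have hyL := mem_union_right L₁ hy
    have h1 : T.adj (f y) v₂ := by rw [fL₂ y hy]; exact (hf₂v y hy).2 (hL y hyL)
    refine ⟨h1, T.adj_of_not_adj
      (hneS z₁ y (hz.trans (hL y hyL)).ne _ (hC₁S hv₁) _ (hfL y hyL)) fun h2 => ?_⟩
    exact htri y hyL v₁ (hC₁S hv₁) v₂ (hC₂S hv₂) _ (hfL y hyL) ⟨hv21, h2, h1⟩
  refine ⟨f, fun x hx => ?_, fun x hx y hy hadj => ?_⟩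
  · rcases mem_insert.1 hx with rfl | hx
    · rw [fz₁]; exact hC₁S hv₁
    · rcases mem_insert.1 hx with rfl | hx
      · rw [fz₂]; exact hC₂S hv₂
      · exact hfL x hx
  · have hasymm := H.asymm x y hadj
    simp only [mem_insert, mem_union] at hx hy
    rcases hx with rfl | rfl | hx | hx <;> rcases hy with rfl | rfl | hy | hy
    · exact absurd hadj hasymm
    · exact absurd hzadj hasymm
    · exact absurd (hL₁ y hy) hasymm
    · rw [fz₁]; exact (harc₂ y hy).2
    · rw [fz₁, fz₂]; exact hv21
    · exact absurd hadj hasymm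
    · rw [fz₂]; exact (harc₁ y hy).2
    · exact absurd (hL₂ y hy) hasymm
    · rw [fz₁]; exact (harc₁ x hx).1
    · exact absurd (hL₁' x hx) hasymm
    · exact hleafT x (mem_union_left _ hx) y (mem_union_left _ hy) hadj
    · exact hleafT x (mem_union_left _ hx) y (mem_union_right _ hy) hadj
    · exact absurd (hL₂' x hx) hasymm
    · rw [fz₂]; exact (harc₂ x hx).1
    · exact hleafT x (mem_union_right _ hx) y (mem_union_left _ hy) hadj
    · exact hleafT x (mem_union_right _ hx) y (mem_union_right _ hy) hadj

end IsSmoothGrid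

lemma exists_levels {h : ℕ} (θ : Equiv.Perm (Fin h)) (Z : Finset (Fin h)) :
    ∃ lev : Fin h → ℕ, (∀ v, 1 ≤ lev v ∧ lev v ≤ 2 * h + 1) ∧
      (∀ v w, pos θ v < pos θ w → lev v ≤ lev w ∧ (v ∈ Z ∨ w ∈ Z → lev v < lev w)) ∧
      ∀ v w, v ∉ Z → w ∉ Z → pos θ v < pos θ w →
        (∀ z ∈ Z, ¬ (pos θ v < pos θ z ∧ pos θ z < pos θ w)) → lev v = lev w := by
  set t : Fin h → ℕ := fun v => (Z.filter fun z => pos θ z ≤ pos θ v).card with ht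
  have htle : ∀ v, t v ≤ h := fun v => (card_le_univ _).trans_eq (Fintype.card_fin h)
  have htmono : ∀ v w, pos θ v < pos θ w → t v ≤ t w := fun v w hvw => by
    refine card_le_card fun z hz => ?_
    rw [mem_filter] at hz ⊢
    exact ⟨hz.1, hz.2.trans hvw.le⟩
  have htlt : ∀ v w, pos θ v < pos θ w → w ∈ Z → t v < t w := fun v w hvw hw => by
    refine card_lt_card ⟨fun z hz => ?_, fun hsub => ?_⟩
    · rw [mem_filter] at hz ⊢
      exact ⟨hz.1, hz.2.trans hvw.le⟩
    · exact (mem_filter.1 (hsub (mem_filter.2 ⟨hw, le_rfl⟩))).2.not_gt hvw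
  have htpos : ∀ v ∈ Z, 1 ≤ t v := fun v hv =>
    Finset.card_pos.2 ⟨v, mem_filter.2 ⟨hv, le_rfl⟩⟩
  refine ⟨fun v => if v ∈ Z then 2 * t v else 2 * t v + 1, fun v => ?_, fun v w hvw => ?_,
    fun v w hv hw hvw hsep => ?_⟩
  · have h1 := htle v
    dsimp only
    split_ifs with hv
    · have h2 := htpos v hv
      omega
    · omega
  · have h1 := htmono v w hvw
    have h2 := htlt v w hvw
    dsimp only
    by_cases hv : v ∈ Z <;> by_cases hw : w ∈ Z <;> simp only [hv, hw, if_true, if_false] <;> grind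
  · simp only [hv, hw, if_false]
    have : t v = t w := by
      refine (htmono v w hvw).antisymm (card_le_card fun z hz => ?_)
      rw [mem_filter] at hz ⊢
      refine ⟨hz.1, not_lt.1 fun hlt => hsep z hz.1 ⟨hlt, lt_of_le_of_ne hz.2 fun heq => ?_⟩⟩
      exact hw (θ.symm.injective heq ▸ hz.1)
    rw [this]

lemma exists_placement {h K R : ℕ} (lv rk : Fin h → ℕ) (hlv : ∀ v, lv v < K)
    (hrk : ∀ v, rk v < R) :
    ∃ φ : Fin h → Fin K ×ₗ Fin R, (∀ v, (ofLex (φ v)).1.val = lv v) ∧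
      ∀ v, (ofLex (φ v)).2.val = rk v :=
  ⟨fun v => toLex (⟨lv v, hlv v⟩, ⟨rk v, hrk v⟩), fun _ => rfl, fun _ => rfl⟩

lemma grid_ext {K R : ℕ} {x y : Fin K ×ₗ Fin R} (h₁ : (ofLex x).1.val = (ofLex y).1.val)
    (h₂ : (ofLex x).2.val = (ofLex y).2.val) : x = y :=
  ofLex.injective (Prod.ext (Fin.ext h₁) (Fin.ext h₂))

/-- Three well separated positions of a grid extend to a placement compatible with an ordering,
in which the vertices of `Z` are first in their level. -/
lemma exists_placement_extending {h K R s : ℕ} (hs : 2 * h + 2 ≤ s) (α : Equiv.Perm (Fin h))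
    (Z : Finset (Fin h)) {a b c : Fin h} (hab : pos α a < pos α b) (hbc : pos α b < pos α c)
    (ha : a ∉ Z) (hb : b ∉ Z) (hc : c ∉ Z) (P₁ P₂ P₃ : Fin K ×ₗ Fin R)
    (h₁ : s ≤ (ofLex P₁).1.val) (h₁₂ : (ofLex P₁).1.val + s ≤ (ofLex P₂).1.val)
    (h₂₃ : (ofLex P₂).1.val + s ≤ (ofLex P₃).1.val) (h₃ : (ofLex P₃).1.val + s ≤ K)
    (hr : s ≤ (ofLex P₃).2.val) (hrR : (ofLex P₃).2.val + s ≤ R) :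
    ∃ ψ : Fin h → Fin K ×ₗ Fin R, ψ a = P₁ ∧ ψ b = P₂ ∧ ψ c = P₃ ∧
      (∀ v w, pos α v < pos α w → ψ v < ψ w) ∧ (∀ z ∈ Z, (ofLex (ψ z)).2.val = 0) ∧
      (∀ v, v ∉ Z → v ≠ a → v ≠ b → (ofLex (ψ v)).2.val ≠ 0) ∧
      ∀ v w, v ∉ insert a (insert b Z) → w ∉ insert a (insert b Z) → pos α v < pos α w →
        (∀ z ∈ insert a (insert b Z), ¬ (pos α v < pos α z ∧ pos α z < pos α w)) →
        (ofLex (ψ v)).1 = (ofLex (ψ w)).1 := by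
  obtain ⟨lev, hlev, hmono, hsame⟩ := exists_levels α (insert a (insert b Z))
  have hlevab := (hmono a b hab).2 (by simp)
  have hlevbc := (hmono b c hbc).2 (by simp)
  set lv : Fin h → ℕ := fun v =>
    if lev v < lev b then (ofLex P₁).1.val + lev v - lev a
    else if lev v < lev c then (ofLex P₂).1.val + lev v - lev b
    else (ofLex P₃).1.val + lev v - lev c with hlv
  set rk : Fin h → ℕ := fun v =>
    if v ∈ Z then 0 else if v = a then (ofLex P₁).2.val else if v = b then (ofLex P₂).2.val
    else (ofLex P₃).2.val + (pos α v).val - (pos α c).val with hrk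
  have hba : b ≠ a := fun h => hab.ne (by rw [h])
  have hca : c ≠ a := fun h => (hab.trans hbc).ne (by rw [h])
  have hcb : c ≠ b := fun h => hbc.ne (by rw [h])
  have hlvlt : ∀ v w, lev v < lev w → lv v < lv w := fun v w hvw => by
    have h1 := hlev v; have h2 := hlev w; have h3 := hlev a; have h4 := hlev b
    have h5 := hlev c
    simp only [hlv]
    split_ifs <;> omega
  have hlva : lv a = (ofLex P₁).1.val := by simp only [hlv]; split_ifs; omega
  have hlvb : lv b = (ofLex P₂).1.val := by simp only [hlv]; split_ifs <;> omega
  have hlvc : lv c = (ofLex P₃).1.val := by simp only [hlv]; split_ifs <;> omega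
  have hrka : rk a = (ofLex P₁).2.val := by simp [hrk, ha]
  have hrkb : rk b = (ofLex P₂).2.val := by simp [hrk, hb, hba]
  have hrkc : rk c = (ofLex P₃).2.val := by simp [hrk, hc, hca, hcb]
  obtain ⟨ψ, hψ₁, hψ₂⟩ := exists_placement (K := K) (R := R) lv rk (fun v => by
    have h1 := hlev v
    simp only [hlv]
    split_ifs <;> omega) (fun v => by
    have h1 := (pos α v).2
    have h2 := (ofLex P₁).2.2
    have h3 := (ofLex P₂).2.2
    simp only [hrk]
    split_ifs <;> omega)
  refine ⟨ψ, grid_ext ((hψ₁ a).trans hlva) ((hψ₂ a).trans hrka),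
    grid_ext ((hψ₁ b).trans hlvb) ((hψ₂ b).trans hrkb),
    grid_ext ((hψ₁ c).trans hlvc) ((hψ₂ c).trans hrkc), fun v w hvw => ?_, fun z hz => ?_,
    fun v hv hva hvb => ?_, fun v w hv hw hvw hsep => ?_⟩
  · rw [grid_lt_iff, hψ₁, hψ₁, hψ₂, hψ₂]
    obtain ⟨hle, hlt⟩ := hmono v w hvw
    rcases hle.lt_or_eq with hlt' | heq
    · exact Or.inl (hlvlt v w hlt')
    · right
      have hnot : ¬ (v ∈ insert a (insert b Z) ∨ w ∈ insert a (insert b Z)) :=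
        fun h => (hlt h).ne heq
      simp only [mem_insert, not_or] at hnot
      obtain ⟨⟨h1, h2, h3⟩, h4, h5, h6⟩ := hnot
      refine ⟨by simp only [hlv, heq], ?_⟩
      simp only [hrk, h1, h2, h3, h4, h5, h6, if_false]
      have := Fin.lt_def.1 hvw
      have := (pos α c).2
      omega
  · rw [hψ₂]
    simp [hrk, hz]
  · rw [hψ₂]
    simp only [hrk, hv, hva, hvb, if_false]
    have := (pos α c).2
    omega
  · rw [Fin.ext_iff, hψ₁, hψ₁]
    simp only [hlv, hsame v w hv hw hvw hsep]

theorem IsSmoothGrid.exists_embedding {h K R : ℕ} {κ : Type*} {T : Tournament n} {lam δ : ℝ}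
    {S : Fin K ×ₗ Fin R → Finset (Fin n)} (hS : T.IsSmoothGrid lam δ S) (hlam : 0 ≤ lam)
    (H : Tournament h) (U : Finset (Fin h)) (A : κ → Finset (Fin h))
    (hA : ∀ i j, i ≠ j → Disjoint (A i) (A j)) (φ : Fin h → Fin K ×ₗ Fin R)
    (S' : Fin h → Finset (Fin n))
    (hfwd : ∀ x ∈ U, ∀ y ∈ U, (¬ ∃ i, x ∈ A i ∧ y ∈ A i) → H.adj x y → φ x < φ y)
    (hS' : ∀ x, S' x ⊆ S (φ x))
    (hcard : ∀ x, (1 / 2 + h * lam) * (S (φ x)).card ≤ (S' x).card)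
    (hgrp : ∀ i, ∀ S'' : Fin h → Finset (Fin n), (∀ x, S'' x ⊆ S' x) →
      (∀ x, ((S (φ x)).card : ℝ) / 2 ≤ (S'' x).card) →
      ∃ f : Fin h → Fin n, (∀ x ∈ A i, f x ∈ S'' x) ∧
        ∀ x ∈ A i, ∀ y ∈ A i, H.adj x y → T.adj (f x) (f y)) :
    ∃ f : Fin h → Fin n, (∀ x ∈ U, f x ∈ S' x) ∧
      ∀ x ∈ U, ∀ y ∈ U, H.adj x y → T.adj (f x) (f y) := by
  obtain ⟨grp, hinl, hinr⟩ := exists_grouping A hA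
  have hsingle : ∀ x y g, grp x = Sum.inr g → grp y = Sum.inr g → ¬ H.adj x y :=
    fun x y g hx hy => by rw [hinr x g hx, hinr y g hy]; exact H.adj_irrefl g
  refine exists_embedding_of_groups T H hlam hS.smooth U grp φ S' (fun x hx y hy hne hadj => ?_)
    hS' hcard fun g S'' hsub hhalf => ?_
  · refine hfwd x hx y hy (fun ⟨i, hxi, hyi⟩ => hne ?_) hadj
    rw [(hinl x i).2 hxi, (hinl y i).2 hyi]
  · rcases g with i | g
    · obtain ⟨f, hf, hfadj⟩ := hgrp i S'' hsub hhalf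
      exact ⟨f, fun x _ hx => hf x ((hinl x i).1 hx), fun x _ y _ hx hy =>
        hfadj x ((hinl x i).1 hx) y ((hinl y i).1 hy)⟩
    · have hne : ∀ x, (S'' x).Nonempty := fun x => by
        have := hS.card_pos (φ x)
        exact Finset.card_pos.1 (Nat.cast_pos.1 (lt_of_lt_of_le (half_pos this) (hhalf x)))
      choose f hf using hne
      exact ⟨f, fun x _ _ => hf x, fun x _ y _ hx hy hadj => absurd hadj (hsingle x y g hx hy)⟩

section Galaxy

variable {h k : ℕ} {G : Tournament h} {α : Equiv.Perm (Fin h)} {a b c : Fin h}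
  {Q : Fin k → Finset (Fin h)} {ctr : Fin k → Fin h} {forb : Fin 1 → Finset (Fin h)}

lemma exists_galaxy_embedding
    (hG : TriGalaxyDecomp G α (fun _ => a) (fun _ => b) (fun _ => c) Q ctr forb)
    {K R : ℕ} {T : Tournament n} {lam δ : ℝ} {S : Fin K ×ₗ Fin R → Finset (Fin n)}
    (hS : T.IsSmoothGrid lam δ S) (hlam0 : 0 ≤ lam) (hlam : h * lam ≤ 1 / 2) (hδ0 : 0 < δ)
    (hδ : 2 * (h + 1) * δ ≤ 1) (ψ : Fin h → Fin K ×ₗ Fin R)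
    (hψ : ∀ v w, pos α v < pos α w → ψ v < ψ w) (hctr : ∀ j, (ofLex (ψ (ctr j))).2.val = 0)
    (hleaf : ∀ j, ∀ y ∈ (Q j).erase (ctr j), (ofLex (ψ y)).2.val ≠ 0)
    (hlevel : ∀ j, ∀ y ∈ (Q j).erase (ctr j), ∀ y' ∈ (Q j).erase (ctr j), pos α y < pos α y' →
      (ofLex (ψ y)).1 = (ofLex (ψ y')).1) :
    ∃ F : Fin h → Fin n, (∀ x ∉ ({a, b, c} : Finset (Fin h)), F x ∈ S (ψ x)) ∧
      ∀ x ∉ ({a, b, c} : Finset (Fin h)), ∀ y ∉ ({a, b, c} : Finset (Fin h)),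
        G.adj x y → T.adj (F x) (F y) := by
  obtain ⟨-, hstar, -, -, hdisj, hback, -⟩ := hG
  have hfwd : ∀ x ∈ ({a, b, c} : Finset (Fin h))ᶜ, ∀ y ∈ ({a, b, c} : Finset (Fin h))ᶜ,
      (¬ ∃ j, x ∈ Q j ∧ y ∈ Q j) → G.adj x y → ψ x < ψ y := fun x hx y hy hne hadj => by
    refine hψ _ _ (pos_lt_of_adj (fun hb => ?_) hadj)
    rcases hback x y hb with ⟨_, h1, _⟩ | h1
    · exact mem_compl.1 hx h1
    · exact hne h1
  have hgrp : ∀ j, ∀ S'' : Fin h → Finset (Fin n), (∀ x, S'' x ⊆ S (ψ x)) →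
      (∀ x, ((S (ψ x)).card : ℝ) / 2 ≤ (S'' x).card) →
      ∃ f : Fin h → Fin n, (∀ x ∈ Q j, f x ∈ S'' x) ∧
        ∀ x ∈ Q j, ∀ y ∈ Q j, G.adj x y → T.adj (f x) (f y) := by
    intro j S'' hsub hhalf
    have hzQ : ctr j ∈ Q j := by
      rcases hstar j with h | h
      · exact h.1
      · exact h.1
    have hstar' := hS.exists_star_embedding hδ0 hδ G ψ S'' hsub hhalf (ctr j)
      ((Q j).erase (ctr j)) (hctr j)
    rw [insert_erase hzQ] at hstar'
    refine hstar' (fun y hy => ?_) (fun y hy y' hy' hadj v hv u hu u' hu' _ _ => ?_)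
    · rcases hstar j with h | h
      · exact Or.inl ⟨hψ _ _ (h.2.2.1 y hy).1, (h.2.2.1 y hy).2⟩
      · exact Or.inr ⟨hψ _ _ (h.2.2.1 y hy).1, (h.2.2.1 y hy).2⟩
    · have hpos : pos α y < pos α y' := by
        refine pos_lt_of_adj (fun hb => ?_) hadj
        rcases hstar j with h | h
        · exact (mem_erase.1 hy').1 (h.2.2.2 _ (mem_erase.1 hy).2 _ (mem_erase.1 hy').2 hb)
        · exact (mem_erase.1 hy).1 (h.2.2.2 _ (mem_erase.1 hy).2 _ (mem_erase.1 hy').2 hb)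
      exact (hS.fwd_of_level _ _ (hlevel j y hy y' hy' hpos) (hleaf j y hy) (hleaf j y' hy') u
        (hsub y hu) u' (hsub y' hu')).1 (hψ _ _ hpos)
  obtain ⟨F, hF, hFadj⟩ := hS.exists_embedding hlam0 G _ Q hdisj ψ (fun x => S (ψ x)) hfwd
    (fun _ => subset_rfl) (fun x => by nlinarith [hS.card_pos (ψ x)]) hgrp
  exact ⟨F, fun x hx => hF x (mem_compl.2 hx), fun x hx y hy =>
    hFadj x (mem_compl.2 hx) y (mem_compl.2 hy)⟩

lemma contains_galaxy_of_triangle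
    (hG : TriGalaxyDecomp G α (fun _ => a) (fun _ => b) (fun _ => c) Q ctr forb)
    (T : Tournament n) (ψ : Fin h → ι) (hψ : ∀ v w, pos α v < pos α w → ψ v < ψ w)
    (F : Fin h → Fin n) (hF : ∀ x ∉ ({a, b, c} : Finset (Fin h)),
      ∀ y ∉ ({a, b, c} : Finset (Fin h)), G.adj x y → T.adj (F x) (F y)) {u v w : Fin n}
    (hu : ∀ g ∉ ({a, b, c} : Finset (Fin h)), T.Fwd (ψ g) (ψ a) (F g) u)
    (hv : ∀ g ∉ ({a, b, c} : Finset (Fin h)), T.Fwd (ψ g) (ψ b) (F g) v)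
    (hw : ∀ g ∉ ({a, b, c} : Finset (Fin h)), T.Fwd (ψ g) (ψ c) (F g) w)
    (hvu : T.adj v u) (hwu : T.adj w u) (hwv : T.adj w v) : T.Contains G := by
  obtain ⟨htri, -, -, htriQ, -, hback, -⟩ := hG
  obtain ⟨hab, hbc, hba', hca', hcb'⟩ := htri 0
  have hba : b ≠ a := fun h => hab.ne (by rw [h])
  have hca : c ≠ a := fun h => (hab.trans hbc).ne (by rw [h])
  have hcb : c ≠ b := fun h => hbc.ne (by rw [h])
  let f : Fin h → Fin n := fun x =>
    if x = a then u else if x = b then v else if x = c then w else F x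
  have fa : f a = u := by simp [f]
  have fb : f b = v := by simp [f, hba]
  have fc : f c = w := by simp [f, hca, hcb]
  have fF : ∀ x ∉ ({a, b, c} : Finset (Fin h)), f x = F x := fun x hx => by
    simp only [mem_insert, mem_singleton, not_or] at hx
    simp [f, hx]
  have hfwd : ∀ e ∈ ({a, b, c} : Finset (Fin h)), ∀ g ∉ ({a, b, c} : Finset (Fin h)),
      T.Fwd (ψ g) (ψ e) (F g) (f e) := fun e he g hg => by
    simp only [mem_insert, mem_singleton] at he
    rcases he with rfl | rfl | rfl
    · rw [fa]; exact hu g hg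
    · rw [fb]; exact hv g hg
    · rw [fc]; exact hw g hg
  have hposlt : ∀ x y, ¬ (x ∈ ({a, b, c} : Finset (Fin h)) ↔ y ∈ ({a, b, c} : Finset (Fin h))) →
      G.adj x y → ψ x < ψ y := fun x y hxy hadj => by
    refine hψ _ _ (pos_lt_of_adj (fun hb => ?_) hadj)
    rcases hback x y hb with ⟨_, h1, h2⟩ | ⟨j, h1, h2⟩
    · exact hxy ⟨fun _ => h2, fun _ => h1⟩
    · exact hxy ⟨fun h => absurd h1 (disjoint_left.1 (htriQ 0 j) h),
        fun h => absurd h2 (disjoint_left.1 (htriQ 0 j) h)⟩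
  refine T.contains_of_hom G f fun x y hadj => ?_
  by_cases hx : x ∈ ({a, b, c} : Finset (Fin h)) <;> by_cases hy : y ∈ ({a, b, c} : Finset (Fin h))
  · have hasymm := G.asymm x y hadj
    simp only [mem_insert, mem_singleton] at hx hy
    rcases hx with hx | hx | hx <;> rcases hy with hy | hy | hy <;> subst hx <;>
      first
      | (subst hy
         first
         | exact absurd hadj hasymm
         | exact absurd hba' hasymm
         | exact absurd hca' hasymm
         | exact absurd hcb' hasymm
         | (rw [fb, fa]; exact hvu)
         | (rw [fc, fa]; exact hwu)
         | (rw [fc, fb]; exact hwv))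
  · rw [fF y hy]
    exact (hfwd x hx y hy).2 (hposlt x y (by simp only [hx, hy]; tauto) hadj)
  · rw [fF x hx]
    exact (hfwd y hy x hx).1 (hposlt x y (by simp only [hx, hy]; tauto) hadj)
  · rw [fF x hx, fF y hy]
    exact hF x hx y hy hadj

end Galaxy

lemma exists_galaxy_environment {h k : ℕ} {G : Tournament h} {α : Equiv.Perm (Fin h)}
    {a b c : Fin h} {Q : Fin k → Finset (Fin h)} {ctr : Fin k → Fin h}
    (hG : TriGalaxyDecomp G α (fun _ : Fin 1 => a) (fun _ => b) (fun _ => c) Q ctr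
      (fun _ => ({a, b} : Finset (Fin h))))
    {K R s : ℕ} {T : Tournament n} {lam δ : ℝ} {S : Fin K ×ₗ Fin R → Finset (Fin n)}
    (hS : T.IsSmoothGrid lam δ S) (hlam0 : 0 ≤ lam) (hlam : h * lam ≤ 1 / 2) (hδ0 : 0 < δ)
    (hδ : 2 * (h + 1) * δ ≤ 1) (hs : 2 * h + 2 ≤ s) (P₁ P₂ P₃ : Fin K ×ₗ Fin R)
    (h₁ : s ≤ (ofLex P₁).1.val) (h₁₂ : (ofLex P₁).1.val + s ≤ (ofLex P₂).1.val)
    (h₂₃ : (ofLex P₂).1.val + s ≤ (ofLex P₃).1.val) (h₃ : (ofLex P₃).1.val + s ≤ K)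
    (hr : s ≤ (ofLex P₃).2.val) (hrR : (ofLex P₃).2.val + s ≤ R) :
    ∃ (ψ : Fin h → Fin K ×ₗ Fin R) (F : Fin h → Fin n), ψ a = P₁ ∧ ψ b = P₂ ∧ ψ c = P₃ ∧
      (∀ v w, pos α v < pos α w → ψ v < ψ w) ∧
      (∀ x ∉ ({a, b, c} : Finset (Fin h)), F x ∈ S (ψ x)) ∧
      ∀ x ∉ ({a, b, c} : Finset (Fin h)), ∀ y ∉ ({a, b, c} : Finset (Fin h)),
        G.adj x y → T.adj (F x) (F y) := by
  obtain ⟨htri, hstar, -, htriQ, hdisj, -, hbet, hforb⟩ := id hG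
  have hctrQ : ∀ j, ctr j ∈ Q j := fun j => (hstar j).elim (fun h => h.1) fun h => h.1
  have hnotQ : ∀ e ∈ ({a, b, c} : Finset (Fin h)), ∀ j, e ∉ Q j := fun e he j =>
    disjoint_left.1 (htriQ 0 j) he
  have hnotZ : ∀ e ∈ ({a, b, c} : Finset (Fin h)), e ∉ univ.image ctr := fun e he hZ => by
    obtain ⟨j, -, rfl⟩ := mem_image.1 hZ
    exact hnotQ _ he j (hctrQ j)
  have hleafZ : ∀ j, ∀ y ∈ (Q j).erase (ctr j), y ∉ univ.image ctr := fun j y hy hZ => by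
    obtain ⟨i, -, rfl⟩ := mem_image.1 hZ
    obtain ⟨h1, h2⟩ := mem_erase.1 hy
    exact disjoint_left.1 (hdisj i j fun hij => h1 (by rw [hij])) (hctrQ i) h2
  have hleafab : ∀ j, ∀ y ∈ (Q j).erase (ctr j), y ≠ a ∧ y ≠ b := fun j y hy =>
    ⟨fun h => hnotQ a (by simp) j (h ▸ (mem_erase.1 hy).2),
      fun h => hnotQ b (by simp) j (h ▸ (mem_erase.1 hy).2)⟩
  obtain ⟨ψ, ha, hb, hc, hψ, hψZ, hψ0, hψlev⟩ := exists_placement_extending hs α (univ.image ctr)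
    (htri 0).1 (htri 0).2.1 (hnotZ a (by simp)) (hnotZ b (by simp)) (hnotZ c (by simp))
    P₁ P₂ P₃ h₁ h₁₂ h₂₃ h₃ hr hrR
  obtain ⟨F, hF, hFadj⟩ := exists_galaxy_embedding hG hS hlam0 hlam hδ0 hδ ψ hψ
    (fun j => hψZ _ (mem_image_of_mem _ (mem_univ j)))
    (fun j y hy => hψ0 y (hleafZ j y hy) (hleafab j y hy).1 (hleafab j y hy).2)
    (fun j y hy y' hy' hyy' => by
      refine hψlev y y' ?_ ?_ hyy' fun z hz hbtw => ?_
      · simp only [mem_insert, not_or]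
        exact ⟨(hleafab j y hy).1, (hleafab j y hy).2, hleafZ j y hy⟩
      · simp only [mem_insert, not_or]
        exact ⟨(hleafab j y' hy').1, (hleafab j y' hy').2, hleafZ j y' hy'⟩
      · rcases mem_insert.1 hz with rfl | hz
        · exact hforb 0 j z (by simp) ⟨y, hy, y', hy', hbtw⟩
        · rcases mem_insert.1 hz with rfl | hz
          · exact hforb 0 j z (by simp) ⟨y, hy, y', hy', hbtw⟩
          · obtain ⟨i, -, rfl⟩ := mem_image.1 hz
            by_cases hij : i = j
            · subst hij
              rcases hstar i with h | h
              · exact (h.2.2.1 y hy).1.not_gt hbtw.1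
              · exact (h.2.2.1 y' hy').1.not_gt hbtw.2
            · exact hbet i j hij ⟨y, hy, y', hy', hbtw⟩)
  exact ⟨ψ, F, ha, hb, hc, hψ, hF, hFadj⟩

theorem exists_triangle_free_subsets {h N k : ℕ} {G : Tournament h} {α : Equiv.Perm (Fin h)}
    {a b c : Fin h} {Q : Fin k → Finset (Fin h)} {ctr : Fin k → Fin h}
    (hG : TriGalaxyDecomp G α (fun _ : Fin 1 => a) (fun _ => b) (fun _ => c) Q ctr
      (fun _ => ({a, b} : Finset (Fin h))))
    {K R s : ℕ} {T : Tournament n} {lam δ : ℝ} {S : Fin K ×ₗ Fin R → Finset (Fin n)}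
    (hS : T.IsSmoothGrid lam δ S) (hlam0 : 0 ≤ lam) (hlam : h * lam ≤ 1 / 2) (hδ0 : 0 < δ)
    (hδ : 2 * (h + 1) * δ ≤ 1) (hs : 2 * h + 2 ≤ s) (hTG : ¬ T.Contains G)
    (φ : Fin N → Fin K ×ₗ Fin R) :
    ∃ S' : Fin N → Finset (Fin n), (∀ x, S' x ⊆ S (φ x)) ∧
      (∀ x, (1 - N ^ 3 * h * lam) * (S (φ x)).card ≤ (S' x).card) ∧
      ∀ x y z, s ≤ (ofLex (φ x)).1.val → (ofLex (φ x)).1.val + s ≤ (ofLex (φ y)).1.val →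
        (ofLex (φ y)).1.val + s ≤ (ofLex (φ z)).1.val → (ofLex (φ z)).1.val + s ≤ K →
        s ≤ (ofLex (φ z)).2.val → (ofLex (φ z)).2.val + s ≤ R →
        ∀ u ∈ S' x, ∀ v ∈ S' y, ∀ w ∈ S' z, ¬ (T.adj v u ∧ T.adj w u ∧ T.adj w v) := by
  let I := {τ : Fin N × Fin N × Fin N // s ≤ (ofLex (φ τ.1)).1.val ∧
    (ofLex (φ τ.1)).1.val + s ≤ (ofLex (φ τ.2.1)).1.val ∧
    (ofLex (φ τ.2.1)).1.val + s ≤ (ofLex (φ τ.2.2)).1.val ∧ (ofLex (φ τ.2.2)).1.val + s ≤ K ∧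
    s ≤ (ofLex (φ τ.2.2)).2.val ∧ (ofLex (φ τ.2.2)).2.val + s ≤ R}
  have henv : ∀ τ : I, _ := fun τ => exists_galaxy_environment hG hS hlam0 hlam hδ0 hδ hs
    (φ τ.1.1) (φ τ.1.2.1) (φ τ.1.2.2) τ.2.1 τ.2.2.1 τ.2.2.2.1 τ.2.2.2.2.1 τ.2.2.2.2.2.1
    τ.2.2.2.2.2.2
  choose ψ F ha hb hc hψ hF hFadj using henv
  set Y : Finset (I × Fin h) := univ.filter fun p => p.2 ∉ ({a, b, c} : Finset (Fin h)) with hY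
  have hYc : (Y.card : ℝ) ≤ N ^ 3 * h := by
    have h1 : Fintype.card I ≤ N ^ 3 := by
      refine (Fintype.card_subtype_le _).trans_eq ?_
      simp only [Fintype.card_prod, Fintype.card_fin]
      ring
    have h2 : Y.card ≤ N ^ 3 * h := by
      refine (card_le_univ Y).trans ?_
      rw [Fintype.card_prod, Fintype.card_fin]
      exact Nat.mul_le_mul_right h h1
    exact_mod_cast h2
  have hsub : ∀ x, ∃ B ⊆ S (φ x),
      (∀ u ∈ B, ∀ p ∈ Y, T.Fwd (ψ p.1 p.2) (φ x) (F p.1 p.2) u) ∧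
      ((S (φ x)).card : ℝ) - Y.card * (lam * (S (φ x)).card) ≤ B.card := fun x =>
    exists_subset_forall (S (φ x)) Y (fun p u => T.Fwd (ψ p.1 p.2) (φ x) (F p.1 p.2) u) _
      fun p hp => hS.smooth _ _ _ (hF p.1 p.2 (mem_filter.1 hp).2)
  choose S' hS' hS'fwd hS'c using hsub
  refine ⟨S', hS', fun x => le_trans ?_ (hS'c x),
    fun x y z h1 h2 h3 h4 h5 h6 u hu v hv w hw hadj => ?_⟩
  · have := mul_le_mul_of_nonneg_right hYc (mul_nonneg hlam0 (hS.card_pos (φ x)).le)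
    linarith
  · let τ : I := ⟨(x, y, z), h1, h2, h3, h4, h5, h6⟩
    have hmem : ∀ g ∉ ({a, b, c} : Finset (Fin h)), (τ, g) ∈ Y := fun g hg =>
      mem_filter.2 ⟨mem_univ _, hg⟩
    refine hTG (contains_galaxy_of_triangle hG T (ψ τ) (hψ τ) (F τ) (hFadj τ) (fun g hg => ?_)
      (fun g hg => ?_) (fun g hg => ?_) hadj.1 hadj.2.1 hadj.2.2)
    · rw [ha τ]; exact hS'fwd x u hu _ (hmem g hg)
    · rw [hb τ]; exact hS'fwd y v hv _ (hmem g hg)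
    · rw [hc τ]; exact hS'fwd z w hw _ (hmem g hg)

theorem contains_superNebula {h m l : ℕ} {H : Tournament h} {θ : Equiv.Perm (Fin h)}
    {Q : Fin m → Finset (Fin h)} {ctr : Fin m → Fin h}
    {Sig : Fin l → Finset (Fin h)} {c₁ c₂ : Fin l → Fin h}
    {L₁ L₂ : Fin l → Finset (Fin h)} {kd : Fin l → NebKind}
    (hN : SuperNebulaDecomp H θ Q ctr Sig c₁ c₂ L₁ L₂ kd)
    (hstars : ∀ i, H.IsOneLeftMiddleStarAt θ (Q i) (ctr i) ∨ H.IsLeftStarAt θ (Q i) (ctr i))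
    (hkd : ∀ i, kd i = NebKind.right) {s : ℕ} (hs : 0 < s) {T : Tournament n} {lam δ : ℝ}
    {S : Fin (s * (2 * h + 2)) ×ₗ Fin (s * (h + 1)) → Finset (Fin n)}
    (hS : T.IsSmoothGrid lam δ S) (hlam0 : 0 ≤ lam) {d : ℝ} (hlam : (d + h) * lam ≤ 1 / 2)
    (hδ0 : 0 < δ) (hδ : 2 * (h + 1) * δ ≤ 1)
    (hfree : ∀ φ : Fin h → Fin (s * (2 * h + 2)) ×ₗ Fin (s * (h + 1)),
      ∃ S' : Fin h → Finset (Fin n), (∀ x, S' x ⊆ S (φ x)) ∧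
      (∀ x, (1 - d * lam) * (S (φ x)).card ≤ (S' x).card) ∧
      ∀ x y z, s ≤ (ofLex (φ x)).1.val → (ofLex (φ x)).1.val + s ≤ (ofLex (φ y)).1.val →
        (ofLex (φ y)).1.val + s ≤ (ofLex (φ z)).1.val →
        (ofLex (φ z)).1.val + s ≤ s * (2 * h + 2) →
        s ≤ (ofLex (φ z)).2.val → (ofLex (φ z)).2.val + s ≤ s * (h + 1) →
        ∀ u ∈ S' x, ∀ v ∈ S' y, ∀ w ∈ S' z, ¬ (T.adj v u ∧ T.adj w u ∧ T.adj w v)) :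
    T.Contains H := by
  obtain ⟨-, hsig, hQQ, hSS, hQS, hback, hctr, hcc⟩ := hN
  simp only [hkd, IsSuper2NebulaAt] at hsig
  have hctrQ : ∀ i, ctr i ∈ Q i := fun i => (hstars i).elim (fun h => h.1.1) fun h => h.1
  have hSig : ∀ i, Sig i = insert (c₁ i) (insert (c₂ i) (L₁ i ∪ L₂ i)) := fun i =>
    (hsig i).1.2.2.2.2.2.2.1
  set Z : Finset (Fin h) := univ.image ctr ∪ (univ.image c₁ ∪ univ.image c₂) with hZ
  have hmemZ : ∀ v, v ∈ Z ↔ (∃ i, ctr i = v) ∨ (∃ i, c₁ i = v) ∨ ∃ i, c₂ i = v := fun v => by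
    simp [hZ]
  have hc₁S : ∀ i, c₁ i ∈ Sig i := fun i => by simp [hSig]
  have hc₂S : ∀ i, c₂ i ∈ Sig i := fun i => by simp [hSig]
  have hLS : ∀ i, ∀ y ∈ L₁ i ∪ L₂ i, y ∈ Sig i := fun i y hy => by
    rw [hSig, mem_insert, mem_insert]; exact Or.inr (Or.inr hy)
  have hQZ : ∀ i, ∀ y ∈ (Q i).erase (ctr i), y ∉ Z := by
    intro i y hy hyZ
    obtain ⟨hne, hyQ⟩ := mem_erase.1 hy
    rcases (hmemZ y).1 hyZ with ⟨j, rfl⟩ | ⟨j, rfl⟩ | ⟨j, rfl⟩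
    · exact disjoint_left.1 (hQQ j i fun hij => hne (by rw [hij])) (hctrQ j) hyQ
    · exact disjoint_left.1 (hQS i j) hyQ (hc₁S j)
    · exact disjoint_left.1 (hQS i j) hyQ (hc₂S j)
  have hLZ : ∀ i, ∀ y ∈ L₁ i ∪ L₂ i, y ∉ Z := by
    intro i y hy hyZ
    have hyS := hLS i y hy
    rcases (hmemZ y).1 hyZ with ⟨j, rfl⟩ | ⟨j, rfl⟩ | ⟨j, rfl⟩
    · exact disjoint_left.1 (hQS j i) (hctrQ j) hyS
    · by_cases hij : j = i
      · subst hij; exact (hsig j).1.2.2.2.1 hy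
      · exact disjoint_left.1 (hSS j i hij) (hc₁S j) hyS
    · by_cases hij : j = i
      · subst hij; exact (hsig j).1.2.2.2.2.1 hy
      · exact disjoint_left.1 (hSS j i hij) (hc₂S j) hyS
  obtain ⟨lev, hlev, hmono, hsame⟩ := exists_levels θ Z
  obtain ⟨φ, hφ₁, hφ₂⟩ := exists_placement (K := s * (2 * h + 2)) (R := s * (h + 1))
    (fun v => s * lev v) (fun v => if v ∈ Z then 0 else s * ((pos θ v).val + 1))
    (fun v => Nat.mul_lt_mul_of_pos_left (by have := (hlev v).2; omega) hs) (fun v => by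
      have h1 := (pos θ v).2
      split_ifs
      · positivity
      · exact Nat.mul_lt_mul_of_pos_left (by omega) hs)
  have hφZ : ∀ z ∈ Z, (ofLex (φ z)).2.val = 0 := fun z hz => by rw [hφ₂, if_pos hz]
  have hφ0 : ∀ z ∉ Z, (ofLex (φ z)).2.val ≠ 0 := fun z hz => by
    rw [hφ₂, if_neg hz]; positivity
  have hφlt : ∀ v w, pos θ v < pos θ w → φ v < φ w := by
    intro v w hvw
    rw [grid_lt_iff, hφ₁, hφ₁, hφ₂, hφ₂]
    obtain ⟨hle, hlt⟩ := hmono v w hvw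
    rcases hle.lt_or_eq with h' | heq
    · exact Or.inl (Nat.mul_lt_mul_of_pos_left h' hs)
    · have hv : v ∉ Z := fun hv => (hlt (Or.inl hv)).ne heq
      have hw : w ∉ Z := fun hw => (hlt (Or.inr hw)).ne heq
      rw [if_neg hv, if_neg hw, heq]
      exact Or.inr ⟨rfl, Nat.mul_lt_mul_of_pos_left (Nat.succ_lt_succ hvw) hs⟩
  have hφne : ∀ v w, v ≠ w → φ v ≠ φ w := fun v w hvw => by
    rcases lt_or_gt_of_ne (fun heq => hvw (θ.symm.injective heq) : pos θ v ≠ pos θ w) with h' | h'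
    · exact (hφlt v w h').ne
    · exact (hφlt w v h').ne'
  obtain ⟨S', hS', hS'c, htri'⟩ := hfree φ
  have htri : ∀ x y z, lev x < lev y → lev y < lev z → z ∉ Z →
      ∀ u ∈ S' x, ∀ v ∈ S' y, ∀ w ∈ S' z, ¬ (T.adj v u ∧ T.adj w u ∧ T.adj w v) := by
    intro x y z hxy hyz hz
    have hgap : ∀ i j, i < j → s * i + s ≤ s * j := fun i j hij => by
      rw [← Nat.mul_succ]; exact Nat.mul_le_mul_left s hij
    refine htri' x y z ?_ ?_ ?_ ?_ ?_ ?_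
    · rw [hφ₁]; exact Nat.le_mul_of_pos_right s (hlev x).1
    · rw [hφ₁, hφ₁]; exact hgap _ _ hxy
    · rw [hφ₁, hφ₁]; exact hgap _ _ hyz
    · rw [hφ₁]; exact hgap _ _ (by have := (hlev z).2; omega)
    · rw [hφ₂, if_neg hz]; exact Nat.le_mul_of_pos_right s (Nat.succ_pos _)
    · rw [hφ₂, if_neg hz]; exact hgap _ _ (by have := (pos θ z).2; omega)
  have hne : ∀ x y, x ≠ y → ∀ u ∈ S' x, ∀ v ∈ S' y, u ≠ v := fun x y hxy u hu v hv huv =>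
    disjoint_left.1 (hS.disjoint _ _ (hφne x y hxy)) (hS' x hu) (hS' y (huv ▸ hv))
  have hlevel : ∀ x y, x ∉ Z → y ∉ Z → pos θ x < pos θ y → lev x = lev y →
      ∀ u ∈ S' x, ∀ v ∈ S' y, T.adj u v := fun x y hx hy hxy hl u hu v hv =>
    (hS.fwd_of_level _ _ (Fin.ext (by rw [hφ₁, hφ₁, hl])) (hφ0 x hx) (hφ0 y hy) u (hS' x hu) v
      (hS' y hv)).1 (hφlt x y hxy)
  have hstarEmb : ∀ i, ∀ S'' : Fin h → Finset (Fin n), (∀ x, S'' x ⊆ S' x) →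
      (∀ x, ((S (φ x)).card : ℝ) / 2 ≤ (S'' x).card) →
      ∃ f : Fin h → Fin n, (∀ x ∈ Q i, f x ∈ S'' x) ∧
        ∀ x ∈ Q i, ∀ y ∈ Q i, H.adj x y → T.adj (f x) (f y) := by
    intro i S'' hsub hhalf
    have hcZ : ctr i ∈ Z := (hmemZ _).2 (Or.inl ⟨i, rfl⟩)
    have hemb := hS.exists_star_embedding hδ0 hδ H φ S'' (fun x => (hsub x).trans (hS' x)) hhalf
      (ctr i) ((Q i).erase (ctr i)) (hφZ _ hcZ)
    rw [insert_erase (hctrQ i)] at hemb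
    refine hemb (fun y hy => ?_) fun y hy y' hy' hadj v hv u hu u' hu' hvu hvu' => ?_
    · rcases hstars i with hst | hst
      · rcases lt_or_gt_of_ne (fun heq => (mem_erase.1 hy).1 (θ.symm.injective heq) :
          pos θ y ≠ pos θ (ctr i)) with h' | h'
        · exact Or.inr ⟨hφlt _ _ h', (hst.1.2.2.2.1 y hy).1 h'⟩
        · exact Or.inl ⟨hφlt _ _ h', (hst.1.2.2.2.1 y hy).2 h'⟩
      · exact Or.inl ⟨hφlt _ _ (hst.2.2.1 y hy).1, (hst.2.2.1 y hy).2⟩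
    · obtain ⟨hyc, hyQ⟩ := mem_erase.1 hy
      obtain ⟨hyc', hyQ'⟩ := mem_erase.1 hy'
      have hyy' : y ≠ y' := fun heq => H.adj_irrefl y' (heq ▸ hadj)
      have hpos : pos θ y < pos θ y' := by
        refine pos_lt_of_adj (fun hb => ?_) hadj
        rcases hstars i with hst | hst
        · exact (hst.1.2.2.2.2 y hyQ y' hyQ' hb).elim hyc hyc'
        · exact hyc' (hst.2.2.2 y hyQ y' hyQ' hb)
      have hcy' : pos θ (ctr i) < pos θ y' := by
        rcases hstars i with hst | hst
        · refine lt_of_not_ge fun hge => ?_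
          have hlt : pos θ y' < pos θ (ctr i) :=
            lt_of_le_of_ne hge fun heq => hyc' (θ.symm.injective heq)
          have h2 : ({y, y'} : Finset (Fin h)) ⊆
              ((Q i).erase (ctr i)).filter fun v => pos θ v < pos θ (ctr i) := by
            intro x hx
            rw [mem_insert, mem_singleton] at hx
            rcases hx with rfl | rfl
            · exact mem_filter.2 ⟨hy, hpos.trans hlt⟩
            · exact mem_filter.2 ⟨hy', hlt⟩
          have h3 := card_le_card h2
          rw [card_pair hyy'] at h3
          have h4 := hst.2
          omega
        · exact (hst.2.2.1 y' hy').1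
      have hu'v : T.adj u' v := hvu'.2 (hφlt _ _ hcy')
      refine T.adj_of_not_adj (hne y y' hyy' u (hsub y hu) u' (hsub y' hu')) fun hu'u => ?_
      have hlc := (hmono _ _ hcy').2 (Or.inl hcZ)
      rcases lt_or_gt_of_ne (fun heq => hyc (θ.symm.injective heq) :
          pos θ y ≠ pos θ (ctr i)) with h' | h'
      · exact htri y (ctr i) y' ((hmono _ _ h').2 (Or.inr hcZ)) hlc (hQZ i y' hy') u (hsub _ hu)
          v (hsub _ hv) u' (hsub _ hu') ⟨hvu.1 (hφlt _ _ h'), hu'u, hu'v⟩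
      · rcases (hmono y y' hpos).1.lt_or_eq with hl | hl
        · exact htri (ctr i) y y' ((hmono _ _ h').2 (Or.inl hcZ)) hl (hQZ i y' hy') v (hsub _ hv)
            u (hsub _ hu) u' (hsub _ hu') ⟨hvu.2 (hφlt _ _ h'), hu'v, hu'u⟩
        · exact T.asymm _ _ hu'u (hlevel y y' (hQZ i y hy) (hQZ i y' hy') hpos hl u (hsub _ hu)
            u' (hsub _ hu'))
  have hsigEmb : ∀ i, ∀ S'' : Fin h → Finset (Fin n), (∀ x, S'' x ⊆ S' x) →
      (∀ x, ((S (φ x)).card : ℝ) / 2 ≤ (S'' x).card) →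
      ∃ f : Fin h → Fin n, (∀ x ∈ Sig i, f x ∈ S'' x) ∧
        ∀ x ∈ Sig i, ∀ y ∈ Sig i, H.adj x y → T.adj (f x) (f y) := by
    intro i S'' hsub hhalf
    obtain ⟨⟨-, -, hLdisj, hc₁L, hc₂L, hcne, -, hcpos⟩, hLpos, hL₁, hL₂, hc21, hb⟩ := hsig i
    have hc₁Z : c₁ i ∈ Z := (hmemZ _).2 (Or.inr (Or.inl ⟨i, rfl⟩))
    have hc₂Z : c₂ i ∈ Z := (hmemZ _).2 (Or.inr (Or.inr ⟨i, rfl⟩))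
    have hnotc : ∀ y ∈ L₁ i ∪ L₂ i, y ≠ c₁ i ∧ y ≠ c₂ i := fun y hy =>
      ⟨fun heq => hc₁L (heq ▸ hy), fun heq => hc₂L (heq ▸ hy)⟩
    have hleaflev : ∀ y ∈ L₁ i ∪ L₂ i, ∀ y' ∈ L₁ i ∪ L₂ i, pos θ y < pos θ y' →
        lev y = lev y' := by
      intro y hy y' hy' hyy'
      refine hsame y y' (hLZ i y hy) (hLZ i y' hy') hyy' fun z hz hbtw => ?_
      have hbet : BetweenSet θ (L₁ i ∪ L₂ i) z := ⟨y, hy, y', hy', hbtw⟩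
      rcases (hmemZ z).1 hz with ⟨j, rfl⟩ | ⟨j, rfl⟩ | ⟨j, rfl⟩
      · exact hctr j i hbet
      · by_cases hij : j = i
        · subst hij; exact (hcpos.trans (hLpos y hy)).not_gt hbtw.1
        · exact (hcc j i hij).1 hbet
      · by_cases hij : j = i
        · subst hij; exact (hLpos y hy).not_gt hbtw.1
        · exact (hcc j i hij).2 hbet
    rw [hSig i]
    refine hS.exists_super_right_embedding hδ0 hδ H φ S'' (fun x => (hsub x).trans (hS' x)) hhalf
      (c₁ i) (c₂ i) (L₁ i) (L₂ i) (hφZ _ hc₁Z) (hφZ _ hc₂Z) (hφlt _ _ hcpos) hc21 hLdisj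
      (fun y hy => hφlt _ _ (hLpos y hy)) hL₁ hL₂ (fun y hy => ?_) (fun y hy => ?_)
      (fun y hy y' hy' hadj u hu u' hu' => ?_) (fun y hy v₁ hv₁ v₂ hv₂ u hu => ?_)
    · have hyL := mem_union_left (L₂ i) hy
      refine H.adj_of_not_adj (hnotc y hyL).2.symm fun hadj => ?_
      rcases hb y (hLS i y hyL) _ (hc₂S i) ⟨hadj, hLpos y hyL⟩ with h' | h' | h'
      · exact hcne h'.2.symm
      · exact disjoint_left.1 hLdisj hy h'.1
      · exact (hnotc y hyL).2 h'.1
    · have hyL := mem_union_right (L₁ i) hy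
      refine H.adj_of_not_adj (hnotc y hyL).1.symm fun hadj => ?_
      rcases hb y (hLS i y hyL) _ (hc₁S i) ⟨hadj, hcpos.trans (hLpos y hyL)⟩ with h' | h' | h'
      · exact disjoint_left.1 hLdisj h'.1 hy
      · exact hcne h'.2
      · exact (hnotc y hyL).2 h'.1
    · have hpos : pos θ y < pos θ y' := by
        refine pos_lt_of_adj (fun hbk => ?_) hadj
        rcases hb y (hLS i y hy) y' (hLS i y' hy') hbk with h' | h' | h'
        · exact (hnotc y' hy').1 h'.2
        · exact (hnotc y' hy').2 h'.2
        · exact (hnotc y' hy').1 h'.2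
      exact hlevel y y' (hLZ i y hy) (hLZ i y' hy') hpos (hleaflev y hy y' hy' hpos) u (hsub _ hu)
        u' (hsub _ hu')
    · exact htri _ _ _ ((hmono _ _ hcpos).2 (Or.inl hc₁Z))
        ((hmono _ _ (hLpos y hy)).2 (Or.inl hc₂Z)) (hLZ i y hy) v₁ (hsub _ hv₁) v₂ (hsub _ hv₂) u
        (hsub _ hu)
  obtain ⟨f, -, hf⟩ := hS.exists_embedding hlam0 H univ (Sum.elim Q Sig)
    (by
      rintro (i | i) (j | j) hij
      · exact hQQ i j fun heq => hij (by rw [heq])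
      · exact hQS i j
      · exact (hQS j i).symm
      · exact hSS i j fun heq => hij (by rw [heq])) φ S'
    (fun x _ y _ hxy hadj => hφlt _ _ (pos_lt_of_adj (fun hb => by
      rcases hback x y hb with ⟨i, hi⟩ | ⟨i, hi⟩
      · exact hxy ⟨Sum.inl i, hi⟩
      · exact hxy ⟨Sum.inr i, hi⟩) hadj)) hS'
    (fun x => le_trans (by nlinarith [hS.card_pos (φ x)]) (hS'c x))
    (by
      rintro (i | i)
      · exact hstarEmb i
      · exact hsigEmb i)
  exact T.contains_of_hom H f fun x y => hf x (mem_univ x) y (mem_univ y)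

end Structure

end Tournament

theorem stmt3 {n₁ n₂ : ℕ} (Nb : Tournament n₁) (θ : Equiv.Perm (Fin n₁))
    {m l : ℕ} (Q : Fin m → Finset (Fin n₁)) (ctr : Fin m → Fin n₁)
    (Sig : Fin l → Finset (Fin n₁)) (c₁ c₂ : Fin l → Fin n₁)
    (L₁ L₂ : Fin l → Finset (Fin n₁)) (kd : Fin l → NebKind)
    (hN : SuperNebulaDecomp Nb θ Q ctr Sig c₁ c₂ L₁ L₂ kd)
    (hstars : ∀ i, Nb.IsOneLeftMiddleStarAt θ (Q i) (ctr i) ∨ Nb.IsLeftStarAt θ (Q i) (ctr i))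
    (hkd : ∀ i, kd i = NebKind.right)
    (G : Tournament n₂) (α : Equiv.Perm (Fin n₂)) (a b c : Fin n₂)
    {k : ℕ} (QG : Fin k → Finset (Fin n₂)) (ctrG : Fin k → Fin n₂)
    (hG : TriGalaxyDecomp G α (fun _ : Fin 1 => a) (fun _ => b) (fun _ => c) QG ctrG
      (fun _ => ({a, b} : Finset (Fin n₂)))) :
    EHPair Nb G := by
  classical
  set s : ℕ := 2 * n₂ + 2 with hs
  set lam : ℝ := 1 / (2 * ((n₁ : ℝ) ^ 3 * n₂ + n₁ + n₂ + 1)) with hlam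
  set δ : ℝ := 1 / (2 * ((n₁ : ℝ) + n₂ + 1)) with hδ
  have hn₁ : (0 : ℝ) ≤ n₁ := n₁.cast_nonneg
  have hn₂ : (0 : ℝ) ≤ n₂ := n₂.cast_nonneg
  have hp : (0 : ℝ) ≤ (n₁ : ℝ) ^ 3 * n₂ := by positivity
  have hlam0 : 0 < lam := by positivity
  have hδ0 : 0 < δ := by positivity
  have hlam1 : lam ≤ 1 := by
    rw [hlam, div_le_one (by positivity)]; linarith
  have hδ1 : δ ≤ 1 := by
    rw [hδ, div_le_one (by positivity)]; linarith
  have hlamG : (n₂ : ℝ) * lam ≤ 1 / 2 := by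
    rw [hlam, mul_one_div, div_le_div_iff₀ (by positivity) (by norm_num)]; linarith
  have hlamN : ((n₁ : ℝ) ^ 3 * n₂ + n₁) * lam ≤ 1 / 2 := by
    rw [hlam, mul_one_div, div_le_div_iff₀ (by positivity) (by norm_num)]; linarith
  have hδG : 2 * ((n₂ : ℝ) + 1) * δ ≤ 1 := by
    rw [hδ, mul_one_div, div_le_one (by positivity)]; linarith
  have hδN : 2 * ((n₁ : ℝ) + 1) * δ ≤ 1 := by
    rw [hδ, mul_one_div, div_le_one (by positivity)]; linarith
  have hs0 : 0 < s := by omega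
  obtain ⟨ε, hε, hgrid⟩ := exists_smoothGrid Nb (K := s * (2 * n₁ + 2)) (R := s * (n₁ + 1))
    (by positivity) (by positivity) hlam0 hlam1 hδ0 hδ1
  refine ⟨ε, hε, fun n T hTN hTG => ?_⟩
  have key : ∀ W : Finset (Fin n), (W.card : ℝ) ^ ε ≤ T.trSizeOn W := by
    intro W
    induction W using Finset.strongInduction with
    | H W ih =>
      by_contra! hW
      obtain ⟨S, hS⟩ := hgrid n T hTN W hW ih
      exact hTN (contains_superNebula hN hstars hkd hs0 hS hlam0.le hlamN hδ0 hδN fun φ =>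
        exists_triangle_free_subsets hG hS hlam0.le hlamG hδ0 hδG hs.ge hTG φ)
  simpa [trSize] using key univ
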